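/- arXiv:2108.11911 — 8 statements merged into one kernel-verified Lean document; each statement's English description precedes it below -/
import Mathlib

section
/- For a collection of binary matrices X(i,j) ∈ {0,1}^{d_i×d_j}, 1 ≤ i < j ≤ n, in which every row sum and every column sum of each X(i,j) is at most 1 (with X(j,i) := X(i,j)^T), the cycle-consistency conditions — for all 1 ≤ i < j < k ≤ n, entrywise X(i,j)X(j,k) ≤ X(i,k), X(j,i)X(i,k) ≤ X(j,k), and X(i,k)X(k,j) ≤ X(i,j) — hold if and only if the linear triangle system (gtri) holds, namely for all l ∈ [d_i], t ∈ [d_j], q ∈ [d_k] and all 1 ≤ i < j < k ≤ n: −X_{lt}(i,j)+X_{tq}(j,k)+X_{lq}(i,k) ≤ 1, X_{lt}(i,j)−X_{tq}(j,k)+X_{lq}(i,k) ≤ 1, and X_{lt}(i,j)+X_{tq}(j,k)−X_{lq}(i,k) ≤ 1. -/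
open Matrix

lemma mul_le_iff_tri {a b c : ℕ} (A : Matrix (Fin a) (Fin b) ℝ) (B : Matrix (Fin b) (Fin c) ℝ)
    (C : Matrix (Fin a) (Fin c) ℝ) (hA : ∀ l t, A l t = 0 ∨ A l t = 1)
    (hB : ∀ l t, B l t = 0 ∨ B l t = 1) (hC : ∀ l t, C l t = 0 ∨ C l t = 1)
    (hr : ∀ l, ∑ t, A l t ≤ 1) :
    (∀ l q, (A * B) l q ≤ C l q) ↔ ∀ l t q, A l t + B t q - C l q ≤ 1 := by
  constructor
  · intro h l t q
    have h1 := h l q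
    rw [Matrix.mul_apply] at h1
    have h2 : A l t * B t q ≤ ∑ s, A l s * B s q :=
      Finset.single_le_sum (f := fun s => A l s * B s q)
        (fun s _ => by rcases hA l s with h | h <;> rcases hB s q with h' | h' <;> simp [h, h'])
        (Finset.mem_univ t)
    rcases hA l t with ha | ha <;> rcases hB t q with hb | hb <;> rcases hC l q with hc | hc <;>
      rw [ha, hb] at h2 <;> rw [ha, hb, hc] <;> linarith
  · intro h l q
    rw [Matrix.mul_apply]
    rcases hC l q with hc | hc
    · rw [hc]
      apply Finset.sum_nonpos
      intro t _
      have h1 := h l t q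
      rcases hA l t with ha | ha <;> rcases hB t q with hb | hb <;> rw [ha, hb] <;>
        rw [ha, hb, hc] at h1 <;> linarith
    · rw [hc]
      refine le_trans (Finset.sum_le_sum fun t _ => ?_) (hr l)
      rcases hA l t with ha | ha <;> rcases hB t q with hb | hb <;> rw [ha, hb] <;> norm_num

/-- For a collection of binary partial-map matrices (row and column sums at most 1,
with `X j i = (X i j)ᵀ`), the matrix-product cycle-consistency conditions hold iff the
linear triangle system (gtri) holds. -/
theorem cycle_consistency_iff_gtri
    (n : ℕ) (hn : 3 ≤ n) (d : Fin n → ℕ) (hd : ∀ i, 1 ≤ d i) (hdmax : ∃ i, 2 ≤ d i)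
    (X : ∀ i j : Fin n, Matrix (Fin (d i)) (Fin (d j)) ℝ)
    (hbin : ∀ i j : Fin n, i < j → ∀ t q, X i j t q = 0 ∨ X i j t q = 1)
    (htr : ∀ i j : Fin n, X j i = (X i j)ᵀ)
    (hrow : ∀ i j : Fin n, i < j → ∀ t, ∑ q, X i j t q ≤ 1)
    (hcol : ∀ i j : Fin n, i < j → ∀ q, ∑ t, X i j t q ≤ 1) :
    (∀ i j k : Fin n, i < j → j < k →
        (∀ l q, (X i j * X j k) l q ≤ X i k l q) ∧
        (∀ t q, (X j i * X i k) t q ≤ X j k t q) ∧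
        (∀ l t, (X i k * X k j) l t ≤ X i j l t)) ↔
    (∀ i j k : Fin n, i < j → j < k →
        ∀ (l : Fin (d i)) (t : Fin (d j)) (q : Fin (d k)),
          - X i j l t + X j k t q + X i k l q ≤ 1 ∧
          X i j l t - X j k t q + X i k l q ≤ 1 ∧
          X i j l t + X j k t q - X i k l q ≤ 1) := by
  refine forall_congr' fun i => forall_congr' fun j => forall_congr' fun k =>
    forall_congr' fun hij => forall_congr' fun hjk => ?_
  have hik := hij.trans hjk
  rw [mul_le_iff_tri (X i j) (X j k) (X i k) (hbin i j hij) (hbin j k hjk) (hbin i k hik)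
      (hrow i j hij),
    mul_le_iff_tri (X j i) (X i k) (X j k)
      (by rw [htr i j]; exact fun l t => hbin i j hij t l) (hbin i k hik) (hbin j k hjk)
      (by rw [htr i j]; exact hcol i j hij),
    mul_le_iff_tri (X i k) (X k j) (X i j) (hbin i k hik)
      (by rw [htr j k]; exact fun l t => hbin j k hjk t l) (hbin i j hij) (hrow i k hik),
    htr i j, htr j k]
  simp only [Matrix.transpose_apply]
  constructor
  · rintro ⟨h1, h2, h3⟩ l t q
    have := h1 l t q
    have := h2 t l q
    have := h3 l q t
    refine ⟨?_, ?_, ?_⟩ <;> linarith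
  · intro h
    refine ⟨fun l t q => ?_, fun t l q => ?_, fun l q t => ?_⟩ <;>
    · obtain ⟨h1, h2, h3⟩ := h l t q
      linarith
end

section
/- Let 1 ≤ i < j < k ≤ n. Then the following consistency inequalities are valid for the feasible region of (IP): (1) −Σ_{t∈D1}Σ_{q∈D2} X_{tq}(i,j) + Σ_{q∈D2} X_{ql}(j,k) + Σ_{t∈D1} X_{tl}(i,k) ≤ 1 for all nonempty D1 ⊆ [d_i], D2 ⊆ [d_j] and all l ∈ [d_k]; (2) Σ_{t∈D1} X_{lt}(i,j) − Σ_{t∈D1}Σ_{q∈D2} X_{tq}(j,k) + Σ_{q∈D2} X_{lq}(i,k) ≤ 1 for all nonempty D1 ⊆ [d_j], D2 ⊆ [d_k] and all l ∈ [d_i]; (3) Σ_{t∈D1} X_{tl}(i,j) + Σ_{q∈D2} X_{lq}(j,k) − Σ_{t∈D1}Σ_{q∈D2} X_{tq}(i,k) ≤ 1 for all nonempty D1 ⊆ [d_i], D2 ⊆ [d_k] and all l ∈ [d_j]. -/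
lemma consistency_aux {a b : ℕ} (D1 : Finset (Fin a)) (D2 : Finset (Fin b))
    (f : Fin a → ℝ) (g : Fin b → ℝ) (h : Fin a → Fin b → ℝ)
    (hf : ∀ t, f t = 0 ∨ f t = 1) (hg : ∀ q, g q = 0 ∨ g q = 1)
    (hh : ∀ t q, h t q = 0 ∨ h t q = 1)
    (sf : ∑ t, f t ≤ 1) (sg : ∑ q, g q ≤ 1)
    (tri : ∀ t q, f t + g q - h t q ≤ 1) :
    ∑ t ∈ D1, f t + ∑ q ∈ D2, g q - ∑ t ∈ D1, ∑ q ∈ D2, h t q ≤ 1 := by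
  have f0 : ∀ t, 0 ≤ f t := fun t => by rcases hf t with e | e <;> simp [e]
  have g0 : ∀ t, 0 ≤ g t := fun t => by rcases hg t with e | e <;> simp [e]
  have h0 : ∀ t q, 0 ≤ h t q := fun t q => by rcases hh t q with e | e <;> simp [e]
  have F : ∑ t ∈ D1, f t ≤ 1 :=
    (Finset.sum_le_sum_of_subset_of_nonneg (Finset.subset_univ D1) (fun t _ _ => f0 t)).trans sf
  have G : ∑ t ∈ D2, g t ≤ 1 :=
    (Finset.sum_le_sum_of_subset_of_nonneg (Finset.subset_univ D2) (fun t _ _ => g0 t)).trans sg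
  have r0 : ∀ t, 0 ≤ ∑ q ∈ D2, h t q := fun t => Finset.sum_nonneg fun q _ => h0 t q
  have H : 0 ≤ ∑ t ∈ D1, ∑ q ∈ D2, h t q := Finset.sum_nonneg fun t _ => r0 t
  by_cases hF : ∀ t ∈ D1, f t = 0
  · have := Finset.sum_eq_zero hF
    linarith
  by_cases hG : ∀ t ∈ D2, g t = 0
  · have := Finset.sum_eq_zero hG
    linarith
  push Not at hF hG
  obtain ⟨t, ht, ft⟩ := hF
  obtain ⟨q, hq, gq⟩ := hG
  have e1 := (hf t).resolve_left ft
  have e2 := (hg q).resolve_left gq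
  have e3 := tri t q
  have e4 : h t q ≤ ∑ q ∈ D2, h t q :=
    Finset.single_le_sum (f := fun q => h t q) (fun q _ => h0 t q) hq
  have e5 : ∑ q ∈ D2, h t q ≤ ∑ t ∈ D1, ∑ q ∈ D2, h t q :=
    Finset.single_le_sum (f := fun t => ∑ q ∈ D2, h t q) (fun t _ => r0 t) ht
  linarith

/-- Consistency inequalities are valid for the feasible region of (IP). -/
theorem consistency_inequalities_valid
    (n : ℕ) (hn : 3 ≤ n) (d : Fin n → ℕ) (hd : ∀ i, 1 ≤ d i) (hdmax : ∃ i, 2 ≤ d i)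
    (X : ∀ i j : Fin n, Matrix (Fin (d i)) (Fin (d j)) ℝ)
    (hbin : ∀ i j : Fin n, i < j → ∀ t q, X i j t q = 0 ∨ X i j t q = 1)
    (hrow : ∀ i j : Fin n, i < j → ∀ t, ∑ q, X i j t q ≤ 1)
    (hcol : ∀ i j : Fin n, i < j → ∀ q, ∑ t, X i j t q ≤ 1)
    (hgtri : ∀ i j k : Fin n, i < j → j < k →
        ∀ (l : Fin (d i)) (t : Fin (d j)) (q : Fin (d k)),
          - X i j l t + X j k t q + X i k l q ≤ 1 ∧
          X i j l t - X j k t q + X i k l q ≤ 1 ∧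
          X i j l t + X j k t q - X i k l q ≤ 1)
    (i j k : Fin n) (hij : i < j) (hjk : j < k) :
    (∀ (D1 : Finset (Fin (d i))) (D2 : Finset (Fin (d j))) (l : Fin (d k)),
        D1.Nonempty → D2.Nonempty →
        -∑ t ∈ D1, ∑ q ∈ D2, X i j t q + ∑ q ∈ D2, X j k q l + ∑ t ∈ D1, X i k t l ≤ 1) ∧
    (∀ (D1 : Finset (Fin (d j))) (D2 : Finset (Fin (d k))) (l : Fin (d i)),
        D1.Nonempty → D2.Nonempty →
        ∑ t ∈ D1, X i j l t - ∑ t ∈ D1, ∑ q ∈ D2, X j k t q + ∑ q ∈ D2, X i k l q ≤ 1) ∧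
    (∀ (D1 : Finset (Fin (d i))) (D2 : Finset (Fin (d k))) (l : Fin (d j)),
        D1.Nonempty → D2.Nonempty →
        ∑ t ∈ D1, X i j t l + ∑ q ∈ D2, X j k l q - ∑ t ∈ D1, ∑ q ∈ D2, X i k t q ≤ 1) := by
  have hik := hij.trans hjk
  refine ⟨fun D1 D2 l _ _ => ?_, fun D1 D2 l _ _ => ?_, fun D1 D2 l _ _ => ?_⟩
  · have := consistency_aux D1 D2 (fun t => X i k t l) (fun q => X j k q l) (fun t q => X i j t q)
      (fun t => hbin i k hik t l) (fun q => hbin j k hjk q l) (hbin i j hij)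
      (hcol i k hik l) (hcol j k hjk l)
      (fun t q => by linarith [(hgtri i j k hij hjk t q l).1])
    linarith
  · have := consistency_aux D1 D2 (fun t => X i j l t) (fun q => X i k l q) (fun t q => X j k t q)
      (fun t => hbin i j hij l t) (fun q => hbin i k hik l q) (hbin j k hjk)
      (hrow i j hij l) (hrow i k hik l)
      (fun t q => by linarith [(hgtri i j k hij hjk l t q).2.1])
    linarith
  · exact consistency_aux D1 D2 (fun t => X i j t l) (fun q => X j k l q) (fun t q => X i k t q)
      (fun t => hbin i j hij t l) (fun q => hbin j k hjk l q) (hbin i k hik)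
      (hcol i j hij l) (hrow j k hjk l)
      (fun t q => (hgtri i j k hij hjk t l q).2.2)
end

section
/- Let 1 ≤ i < j < k ≤ n. Then the following block consistency inequalities are valid for the feasible region of (IP): (1) −Σ_{t∈D1}Σ_{q∈D2} X_{tq}(i,j) + Σ_{q∈D2}Σ_{l∈D3} X_{ql}(j,k) + Σ_{t∈D1}Σ_{l∈D3} X_{tl}(i,k) ≤ |D3| for all nonempty D1 ⊆ [d_i], D2 ⊆ [d_j], D3 ⊆ [d_k]; (2) Σ_{l∈D3}Σ_{t∈D1} X_{lt}(i,j) − Σ_{t∈D1}Σ_{q∈D2} X_{tq}(j,k) + Σ_{l∈D3}Σ_{q∈D2} X_{lq}(i,k) ≤ |D3| for all nonempty D1 ⊆ [d_j], D2 ⊆ [d_k], D3 ⊆ [d_i]; (3) Σ_{t∈D1}Σ_{l∈D3} X_{tl}(i,j) + Σ_{l∈D3}Σ_{q∈D2} X_{lq}(j,k) − Σ_{t∈D1}Σ_{q∈D2} X_{tq}(i,k) ≤ |D3| for all nonempty D1 ⊆ [d_i], D2 ⊆ [d_k], D3 ⊆ [d_j]. -/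
/-- Core inequality: `c` ranges over the block whose cardinality is the right-hand side. -/
lemma block_core {P C Q : Type*} [Fintype P] [Fintype C] [Fintype Q]
    (a : P → C → ℝ) (b : C → Q → ℝ) (x : P → Q → ℝ)
    (ha : ∀ p c, a p c = 0 ∨ a p c = 1) (hb : ∀ c q, b c q = 0 ∨ b c q = 1)
    (hx : ∀ p q, x p q = 0 ∨ x p q = 1)
    (hac : ∀ c, ∑ p, a p c ≤ 1) (hap : ∀ p, ∑ c, a p c ≤ 1) (hbc : ∀ c, ∑ q, b c q ≤ 1)
    (htri : ∀ p c q, a p c + b c q - x p q ≤ 1)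
    (D1 : Finset P) (D2 : Finset Q) (D3 : Finset C) :
    ∑ c ∈ D3, ∑ p ∈ D1, a p c + ∑ c ∈ D3, ∑ q ∈ D2, b c q
      ≤ (D3.card : ℝ) + ∑ p ∈ D1, ∑ q ∈ D2, x p q := by
  have ha0 : ∀ p c, 0 ≤ a p c := fun p c => by rcases ha p c with h | h <;> rw [h] <;> norm_num
  have hb0 : ∀ c q, 0 ≤ b c q := fun p c => by rcases hb p c with h | h <;> rw [h] <;> norm_num
  have hA : ∀ c, ∑ p ∈ D1, a p c ≤ 1 := fun c =>
    (Finset.sum_le_univ_sum_of_nonneg (fun p => ha0 p c)).trans (hac c)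
  have hB : ∀ c, ∑ q ∈ D2, b c q ≤ 1 := fun c =>
    (Finset.sum_le_univ_sum_of_nonneg (fun q => hb0 c q)).trans (hbc c)
  have hP : ∀ p, ∑ c ∈ D3, a p c ≤ 1 := fun p =>
    (Finset.sum_le_univ_sum_of_nonneg (fun c => ha0 p c)).trans (hap p)
  have h1 : ∑ c ∈ D3, (∑ p ∈ D1, a p c + ∑ q ∈ D2, b c q)
      ≤ ∑ c ∈ D3, (1 + ∑ p ∈ D1, ∑ q ∈ D2, a p c * b c q) := by
    refine Finset.sum_le_sum fun c _ => ?_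
    rw [← Finset.sum_mul_sum]
    nlinarith [mul_nonneg (sub_nonneg.2 (hA c)) (sub_nonneg.2 (hB c))]
  have h2 : ∑ c ∈ D3, ∑ p ∈ D1, ∑ q ∈ D2, a p c * b c q ≤ ∑ p ∈ D1, ∑ q ∈ D2, x p q := by
    rw [Finset.sum_comm]
    refine Finset.sum_le_sum fun p _ => ?_
    rw [Finset.sum_comm]
    refine Finset.sum_le_sum fun q _ => ?_
    rcases hx p q with h | h
    · rw [h]
      refine Finset.sum_nonpos fun c _ => ?_
      have := htri p c q
      rcases ha p c with h1 | h1 <;> rcases hb c q with h2 | h2 <;> rw [h1, h2, h] at this <;> rw [h1, h2] <;>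
        linarith
    · rw [h]
      refine (Finset.sum_le_sum fun c _ => ?_).trans (hP p)
      have := ha0 p c
      rcases hb c q with h2 | h2 <;> rw [h2] <;> linarith
  simp only [Finset.sum_add_distrib, Finset.sum_const, nsmul_eq_mul, mul_one] at h1
  linarith

/-- Block consistency inequalities are valid for the feasible region of (IP). -/
theorem block_consistency_inequalities_valid
    (n : ℕ) (hn : 3 ≤ n) (d : Fin n → ℕ) (hd : ∀ i, 1 ≤ d i) (hdmax : ∃ i, 2 ≤ d i)
    (X : ∀ i j : Fin n, Matrix (Fin (d i)) (Fin (d j)) ℝ)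
    (hbin : ∀ i j : Fin n, i < j → ∀ t q, X i j t q = 0 ∨ X i j t q = 1)
    (hrow : ∀ i j : Fin n, i < j → ∀ t, ∑ q, X i j t q ≤ 1)
    (hcol : ∀ i j : Fin n, i < j → ∀ q, ∑ t, X i j t q ≤ 1)
    (hgtri : ∀ i j k : Fin n, i < j → j < k →
        ∀ (l : Fin (d i)) (t : Fin (d j)) (q : Fin (d k)),
          - X i j l t + X j k t q + X i k l q ≤ 1 ∧
          X i j l t - X j k t q + X i k l q ≤ 1 ∧
          X i j l t + X j k t q - X i k l q ≤ 1)
    (i j k : Fin n) (hij : i < j) (hjk : j < k) :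
    (∀ (D1 : Finset (Fin (d i))) (D2 : Finset (Fin (d j))) (D3 : Finset (Fin (d k))),
        D1.Nonempty → D2.Nonempty → D3.Nonempty →
        -∑ t ∈ D1, ∑ q ∈ D2, X i j t q + ∑ q ∈ D2, ∑ l ∈ D3, X j k q l
          + ∑ t ∈ D1, ∑ l ∈ D3, X i k t l ≤ (D3.card : ℝ)) ∧
    (∀ (D1 : Finset (Fin (d j))) (D2 : Finset (Fin (d k))) (D3 : Finset (Fin (d i))),
        D1.Nonempty → D2.Nonempty → D3.Nonempty →
        ∑ l ∈ D3, ∑ t ∈ D1, X i j l t - ∑ t ∈ D1, ∑ q ∈ D2, X j k t q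
          + ∑ l ∈ D3, ∑ q ∈ D2, X i k l q ≤ (D3.card : ℝ)) ∧
    (∀ (D1 : Finset (Fin (d i))) (D2 : Finset (Fin (d k))) (D3 : Finset (Fin (d j))),
        D1.Nonempty → D2.Nonempty → D3.Nonempty →
        ∑ t ∈ D1, ∑ l ∈ D3, X i j t l + ∑ l ∈ D3, ∑ q ∈ D2, X j k l q
          - ∑ t ∈ D1, ∑ q ∈ D2, X i k t q ≤ (D3.card : ℝ)) := by
  have hik := hij.trans hjk
  refine ⟨fun D1 D2 D3 _ _ _ => ?_, fun D1 D2 D3 _ _ _ => ?_, fun D1 D2 D3 _ _ _ => ?_⟩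
  · have := block_core (X i k) (fun l q => X j k q l) (X i j) (hbin i k hik)
      (fun l q => hbin j k hjk q l) (hbin i j hij) (hcol i k hik) (hrow i k hik) (hcol j k hjk)
      (fun p c q => by have := (hgtri i j k hij hjk p q c).1; linarith) D1 D2 D3
    have e1 : ∑ q ∈ D2, ∑ l ∈ D3, X j k q l = ∑ l ∈ D3, ∑ q ∈ D2, X j k q l := Finset.sum_comm
    have e2 : ∑ t ∈ D1, ∑ l ∈ D3, X i k t l = ∑ l ∈ D3, ∑ t ∈ D1, X i k t l := Finset.sum_comm
    linarith
  · have := block_core (fun t l => X i j l t) (X i k) (X j k) (fun t l => hbin i j hij l t)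
      (hbin i k hik) (hbin j k hjk) (hrow i j hij) (hcol i j hij) (hrow i k hik)
      (fun p c q => by have := (hgtri i j k hij hjk c p q).2.1; linarith) D1 D2 D3
    linarith
  · have := block_core (X i j) (X j k) (X i k) (hbin i j hij)
      (hbin j k hjk) (hbin i k hik) (hcol i j hij) (hrow i j hij) (hrow j k hjk)
      (fun p c q => (hgtri i j k hij hjk p c q).2.2) D1 D2 D3
    have e1 : ∑ t ∈ D1, ∑ l ∈ D3, X i j t l = ∑ l ∈ D3, ∑ t ∈ D1, X i j t l := Finset.sum_comm
    linarith
end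

section
/- For all n ≥ 3 and d ≥ 2, the joint matching polytope C_{n,d} is full dimensional; that is, its affine dimension equals (n choose 2)·d², the dimension of the ambient space ℝ^{(n choose 2)d²}. -/
/-- Index set of ordered pairs `i < j`. -/
abbrev PairIdx (n : ℕ) := {p : Fin n × Fin n // p.1 < p.2}

/-- Coordinates of the vectorization of a collection of matrices `X(i,j)`, `i < j`. -/
abbrev JIdx (n d : ℕ) := PairIdx n × (Fin d × Fin d)

/-- `x` is the vectorization of a collection of consistent partial maps: binary entries,
row and column sums at most one, and the triangle system (gtri). -/
def IsConsistentVec (n d : ℕ) (x : JIdx n d → ℝ) : Prop :=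
  (∀ (e : PairIdx n) (t q : Fin d), x (e, (t, q)) = 0 ∨ x (e, (t, q)) = 1) ∧
  (∀ (e : PairIdx n) (t : Fin d), ∑ q : Fin d, x (e, (t, q)) ≤ 1) ∧
  (∀ (e : PairIdx n) (q : Fin d), ∑ t : Fin d, x (e, (t, q)) ≤ 1) ∧
  (∀ (i j k : Fin n) (hij : i < j) (hjk : j < k) (l t q : Fin d),
      - x (⟨(i, j), hij⟩, (l, t)) + x (⟨(j, k), hjk⟩, (t, q))
          + x (⟨(i, k), lt_trans hij hjk⟩, (l, q)) ≤ 1 ∧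
      x (⟨(i, j), hij⟩, (l, t)) - x (⟨(j, k), hjk⟩, (t, q))
          + x (⟨(i, k), lt_trans hij hjk⟩, (l, q)) ≤ 1 ∧
      x (⟨(i, j), hij⟩, (l, t)) + x (⟨(j, k), hjk⟩, (t, q))
          - x (⟨(i, k), lt_trans hij hjk⟩, (l, q)) ≤ 1)

/-- The joint matching polytope `C_{n,d}`: the convex hull of the vectorizations of all
consistent partial maps. -/
def jointMatchingPolytope (n d : ℕ) : Set (JIdx n d → ℝ) :=
  convexHull ℝ {x | IsConsistentVec n d x}

lemma card_pairIdx (n : ℕ) : Fintype.card (PairIdx n) = n.choose 2 := by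
  rw [Fintype.card_subtype, Finset.card_filter, Fintype.sum_prod_type_right]
  have h : ∀ j : Fin n, (∑ i : Fin n, if i < j then 1 else 0) = (j : ℕ) := by
    intro j
    rw [← Finset.card_filter, Finset.filter_gt_eq_Iio, Fin.card_Iio]
  simp only [h]
  rw [Fin.sum_univ_eq_sum_range (fun i => i) n, Finset.sum_range_id, Nat.choose_two_right]

lemma zero_consistent (n d : ℕ) : IsConsistentVec n d 0 := by
  refine ⟨?_, ?_, ?_, ?_⟩ <;> intros <;> simp

lemma single_consistent (n d : ℕ) (c : JIdx n d) :
    IsConsistentVec n d (Pi.single c 1) := by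
  obtain ⟨e, a, b⟩ := c
  refine ⟨?_, ?_, ?_, ?_⟩
  · intro e' t q
    by_cases h : (e', (t, q)) = (e, (a, b))
    · right; rw [h]; simp
    · left; simp [Pi.single_apply, h]
  · intro e' t
    by_cases h : e' = e ∧ t = a
    · obtain ⟨rfl, rfl⟩ := h
      simp [Pi.single_apply]
    · rw [Finset.sum_eq_zero]
      · exact zero_le_one
      · intro q _
        rw [Pi.single_apply, if_neg]
        rintro heq
        simp only [Prod.mk.injEq] at heq
        exact h ⟨heq.1, heq.2.1⟩
  · intro e' t
    by_cases h : e' = e ∧ t = b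
    · obtain ⟨rfl, rfl⟩ := h
      simp [Pi.single_apply]
    · rw [Finset.sum_eq_zero]
      · exact zero_le_one
      · intro q _
        rw [Pi.single_apply, if_neg]
        rintro heq
        simp only [Prod.mk.injEq] at heq
        exact h ⟨heq.1, heq.2.2⟩
  · intro i j k hij hjk l t q
    have h1 : ¬ (i = j) := hij.ne
    have h2 : ¬ (j = k) := hjk.ne
    simp only [Pi.single_apply, Prod.mk.injEq, Subtype.ext_iff, Prod.ext_iff]
    refine ⟨?_, ?_, ?_⟩ <;> split_ifs <;> first | (norm_num; done) | (exfalso; grind)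

/-- The joint matching polytope is full dimensional: its affine dimension equals
`(n choose 2) * d ^ 2`. -/
theorem jointMatchingPolytope_full_dimensional (n d : ℕ) (hn : 3 ≤ n) (hd : 2 ≤ d) :
    Module.finrank ℝ ↥(vectorSpan ℝ (jointMatchingPolytope n d)) = n.choose 2 * d ^ 2 := by
  have htop : vectorSpan ℝ (jointMatchingPolytope n d) = ⊤ := by
    rw [eq_top_iff, ← (Pi.basisFun ℝ (JIdx n d)).span_eq, Submodule.span_le]
    rintro _ ⟨c, rfl⟩
    have h := vsub_mem_vectorSpan ℝ
      (subset_convexHull ℝ {x | IsConsistentVec n d x} (single_consistent n d c))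
      (subset_convexHull ℝ {x | IsConsistentVec n d x} (zero_consistent n d))
    simpa [jointMatchingPolytope] using h
  rw [htop, finrank_top, Module.finrank_fintype_fun_eq_card, Fintype.card_prod, card_pairIdx]
  simp [sq]
end

section
/- For all n ≥ 3 and d ≥ 2, every consistency inequality is facet-defining for the joint matching polytope C_{n,d}: for all nonempty D1, D2 ⊆ [d], all indices l ∈ [d], and all 1 ≤ i < j < k ≤ n, each of the inequalities −Σ_{t∈D1}Σ_{q∈D2} X_{tq}(i,j) + Σ_{q∈D2} X_{ql}(j,k) + Σ_{t∈D1} X_{tl}(i,k) ≤ 1, Σ_{t∈D1} X_{lt}(i,j) − Σ_{t∈D1}Σ_{q∈D2} X_{tq}(j,k) + Σ_{q∈D2} X_{lq}(i,k) ≤ 1, and Σ_{t∈D1} X_{tl}(i,j) + Σ_{q∈D2} X_{lq}(j,k) − Σ_{t∈D1}Σ_{q∈D2} X_{tq}(i,k) ≤ 1 is valid for C_{n,d} and the face on which it holds with equality has affine dimension (n choose 2)d² − 1. -/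
namespace JMP

/-- First endpoint of a coordinate. -/
def src {n d : ℕ} (e : JIdx n d) : Fin n × Fin d := (e.1.1.1, e.2.1)
/-- Second endpoint of a coordinate. -/
def tgt {n d : ℕ} (e : JIdx n d) : Fin n × Fin d := (e.1.1.2, e.2.2)

/-- Symmetric coordinate functional. -/
noncomputable def S {n d : ℕ} (u v : Fin n × Fin d) : (JIdx n d → ℝ) →ₗ[ℝ] ℝ :=
  if h : u.1 < v.1 then LinearMap.proj (⟨(u.1, v.1), h⟩, (u.2, v.2))
  else if h : v.1 < u.1 then LinearMap.proj (⟨(v.1, u.1), h⟩, (v.2, u.2))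
  else 0

/-- Symmetric basis vector. -/
noncomputable def E {n d : ℕ} (u v : Fin n × Fin d) : JIdx n d → ℝ :=
  fun e => if (u = src e ∧ v = tgt e) ∨ (u = tgt e ∧ v = src e) then 1 else 0

/-- Vector of a colouring. -/
noncomputable def pt {n d : ℕ} (c : Fin n × Fin d → Fin n × Fin d) : JIdx n d → ℝ :=
  fun e => if c (src e) = c (tgt e) then 1 else 0

lemma pt_apply {n d : ℕ} (c : Fin n × Fin d → Fin n × Fin d) (e : PairIdx n) (s t : Fin d) :
    pt c (e, (s, t)) = if c (e.1.1, s) = c (e.1.2, t) then 1 else 0 := rfl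

lemma E_apply {n d : ℕ} (u v : Fin n × Fin d) (e : PairIdx n) (s t : Fin d) :
    E u v (e, (s, t)) = if (u = (e.1.1, s) ∧ v = (e.1.2, t)) ∨ (u = (e.1.2, t) ∧ v = (e.1.1, s))
      then 1 else 0 := rfl

lemma S_of_lt {n d : ℕ} {i j : Fin n} (h : i < j) (s t : Fin d) (x : JIdx n d → ℝ) :
    S (i, s) (j, t) x = x (⟨(i, j), h⟩, (s, t)) := by
  simp [S, h]

lemma S_of_gt {n d : ℕ} {i j : Fin n} (h : j < i) (s t : Fin d) (x : JIdx n d → ℝ) :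
    S (i, s) (j, t) x = x (⟨(j, i), h⟩, (t, s)) := by
  simp [S, h, not_lt.mpr h.le]

lemma S_comm {n d : ℕ} (u v : Fin n × Fin d) (x : JIdx n d → ℝ) :
    S u v x = S v u x := by
  obtain ⟨i, s⟩ := u
  obtain ⟨j, t⟩ := v
  rcases lt_trichotomy i j with h | h | h
  · rw [S_of_lt h, S_of_gt h]
  · subst h; simp [S]
  · rw [S_of_lt h, S_of_gt h]

lemma S_E {n d : ℕ} (u v p q : Fin n × Fin d) (h : p.1 ≠ q.1) :
    S p q (E u v) = if (u = p ∧ v = q) ∨ (u = q ∧ v = p) then 1 else 0 := by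
  obtain ⟨i, s⟩ := p
  obtain ⟨j, t⟩ := q
  rcases lt_or_gt_of_ne h with h | h
  · rw [S_of_lt h, E_apply]
  · rw [S_of_gt h, E_apply]; congr 1; exact propext or_comm

lemma pt_consistent {n d : ℕ} (c : Fin n × Fin d → Fin n × Fin d)
    (hc : ∀ a s t, c (a, s) = c (a, t) → s = t) : IsConsistentVec n d (pt c) := by
  refine ⟨?_, ?_, ?_, ?_⟩
  · intro e t q
    simp only [pt]
    split_ifs <;> simp
  · intro e t
    simp only [pt_apply, Finset.sum_boole]
    have : (Finset.univ.filter fun q => c (e.1.1, t) = c (e.1.2, q)).card ≤ 1 := by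
      rw [Finset.card_le_one]
      intro q hq r hr
      simp only [Finset.mem_filter, Finset.mem_univ, true_and] at hq hr
      exact hc _ _ _ (hq.symm.trans hr)
    exact_mod_cast this
  · intro e t
    simp only [pt_apply, Finset.sum_boole]
    have : (Finset.univ.filter fun q => c (e.1.1, q) = c (e.1.2, t)).card ≤ 1 := by
      rw [Finset.card_le_one]
      intro q hq r hr
      simp only [Finset.mem_filter, Finset.mem_univ, true_and] at hq hr
      exact hc _ _ _ (hq.trans hr.symm)
    exact_mod_cast this
  · intro i j k hij hjk l t q
    simp only [pt_apply]
    refine ⟨?_, ?_, ?_⟩ <;> split_ifs <;> first | (norm_num; done) | (exfalso; grind)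

lemma src_ne_tgt {n d : ℕ} (e : JIdx n d) : (src e).1 ≠ (tgt e).1 := e.1.2.ne

lemma cons_one {n d : ℕ} (p q : Fin n × Fin d) (h : p.1 ≠ q.1) :
    IsConsistentVec n d (E p q) := by
  have : E p q = pt (fun x => if x = q then p else x) := by
    funext e
    have := src_ne_tgt e
    simp only [E, pt]
    congr 1
    grind
  rw [this]
  apply pt_consistent
  grind

lemma cons_two {n d : ℕ} (p q u v : Fin n × Fin d) (h : p.1 ≠ q.1) (h' : u.1 ≠ v.1)
    (h1 : u ≠ p) (h2 : u ≠ q) (h3 : v ≠ p) (h4 : v ≠ q) :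
    IsConsistentVec n d (E p q + E u v) := by
  have : E p q + E u v = pt (fun x => if x = q then p else if x = v then u else x) := by
    funext e
    have := src_ne_tgt e
    simp only [E, pt, Pi.add_apply]
    generalize src e = a at *
    generalize tgt e = b at *
    have h5 : p ≠ q := fun h0 => h (by rw [h0])
    have h6 : u ≠ v := fun h0 => h' (by rw [h0])
    have h7 : a ≠ b := fun h0 => this (by rw [h0])
    split_ifs <;> first | (norm_num; done) | (exfalso; grind)
  rw [this]
  apply pt_consistent
  grind

lemma cons_three {n d : ℕ} (p q v : Fin n × Fin d) (h : p.1 ≠ q.1) (h' : p.1 ≠ v.1)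
    (h1 : q.1 ≠ v.1) :
    IsConsistentVec n d (E p q + E p v + E q v) := by
  have : E p q + E p v + E q v = pt (fun x => if x = q then p else if x = v then p else x) := by
    funext e
    have := src_ne_tgt e
    simp only [E, pt, Pi.add_apply]
    generalize src e = a at *
    generalize tgt e = b at *
    have h5 : p ≠ q := fun h0 => h (by rw [h0])
    have h6 : p ≠ v := fun h0 => h' (by rw [h0])
    have h8 : q ≠ v := fun h0 => h1 (by rw [h0])
    have h7 : a ≠ b := fun h0 => this (by rw [h0])
    split_ifs <;> first | (norm_num; done) | (exfalso; grind)
  rw [this]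
  apply pt_consistent
  grind

lemma card_JIdx (n d : ℕ) : Fintype.card (JIdx n d) = n.choose 2 * d ^ 2 := by
  have e : PairIdx n ≃ Σ j : Fin n, Fin j.1 :=
    { toFun := fun p => ⟨p.1.2, ⟨p.1.1.1, p.2⟩⟩
      invFun := fun s => ⟨(⟨s.2.1, s.2.2.trans s.1.2⟩, s.1), s.2.2⟩
      left_inv := fun p => rfl
      right_inv := fun s => rfl }
  rw [Fintype.card_prod, Fintype.card_congr e, Fintype.card_sigma, Fintype.card_prod]
  simp only [Fintype.card_fin]
  rw [Fin.sum_univ_eq_sum_range (fun i => i) n, Finset.sum_range_id, Nat.choose_two_right, sq]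

/-- The consistency functional. -/
noncomputable def phi {n d : ℕ} (L : Fin n × Fin d) (A B : Finset (Fin n × Fin d)) :
    (JIdx n d → ℝ) →ₗ[ℝ] ℝ :=
  ∑ v ∈ B, S L v + ∑ u ∈ A, S L u - ∑ u ∈ A, ∑ v ∈ B, S u v

lemma phi_apply {n d : ℕ} (L : Fin n × Fin d) (A B : Finset (Fin n × Fin d))
    (x : JIdx n d → ℝ) : phi L A B x =
      ∑ v ∈ B, S L v x + ∑ u ∈ A, S L u x - ∑ u ∈ A, ∑ v ∈ B, S u v x := by
  simp [phi, LinearMap.sum_apply]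

lemma phi_E
    {n d : ℕ} (L : Fin n × Fin d) (A B : Finset (Fin n × Fin d)) (a b : Fin n)
    (hA : ∀ u ∈ A, u.1 = a) (hB : ∀ u ∈ B, u.1 = b) (hab : a ≠ b) (hLa : L.1 ≠ a)
    (hLb : L.1 ≠ b)
    (u v : Fin n × Fin d) : phi L A B (E u v) =
    (∑ w ∈ B, if (u = L ∧ v = w) ∨ (u = w ∧ v = L) then (1:ℝ) else 0)
    + (∑ w ∈ A, if (u = L ∧ v = w) ∨ (u = w ∧ v = L) then 1 else 0)
    - ∑ p ∈ A, ∑ q ∈ B, if (u = p ∧ v = q) ∨ (u = q ∧ v = p) then 1 else 0 := by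
  rw [phi_apply]
  congr 1
  · congr 1
    · refine Finset.sum_congr rfl fun w hw => S_E _ _ _ _ ?_
      rw [hB w hw]; exact hLb
    · refine Finset.sum_congr rfl fun w hw => S_E _ _ _ _ ?_
      rw [hA w hw]; exact hLa
  · refine Finset.sum_congr rfl fun p hp => Finset.sum_congr rfl fun q hq => S_E _ _ _ _ ?_
    rw [hA p hp, hB q hq]; exact hab

lemma phi_E_L
    {n d : ℕ} (L : Fin n × Fin d) (A B : Finset (Fin n × Fin d)) (a b : Fin n)
    (hA : ∀ u ∈ A, u.1 = a) (hB : ∀ u ∈ B, u.1 = b) (hab : a ≠ b) (hLa : L.1 ≠ a)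
    (hLb : L.1 ≠ b)
    (v : Fin n × Fin d) (hv : v ∈ A ∨ v ∈ B) : phi L A B (E L v) = 1 := by
  rw [phi_E L A B a b hA hB hab hLa hLb]
  have hLA : L ∉ A := fun h => hLa (hA L h)
  have hLB : L ∉ B := fun h => hLb (hB L h)
  have h0 : ∑ p ∈ A, ∑ q ∈ B, (if (L = p ∧ v = q) ∨ (L = q ∧ v = p) then (1:ℝ) else 0) = 0 :=
    Finset.sum_eq_zero fun p hp => Finset.sum_eq_zero fun q hq => if_neg (by grind)
  rw [h0]
  have key : ∀ C : Finset (Fin n × Fin d), L ∉ C →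
      (∑ w ∈ C, if (L = L ∧ v = w) ∨ (L = w ∧ v = L) then (1:ℝ) else 0)
        = if v ∈ C then 1 else 0 := by
    intro C hC
    rw [← Finset.sum_ite_eq C v (fun _ => (1:ℝ))]
    refine Finset.sum_congr rfl fun w hw => ?_
    congr 1
    grind
  rw [key A hLA, key B hLB]
  have : ¬ (v ∈ A ∧ v ∈ B) := fun h => hab ((hA v h.1).symm.trans (hB v h.2))
  grind

lemma phi_E_cross
    {n d : ℕ} (L : Fin n × Fin d) (A B : Finset (Fin n × Fin d)) (a b : Fin n)
    (hA : ∀ u ∈ A, u.1 = a) (hB : ∀ u ∈ B, u.1 = b) (hab : a ≠ b) (hLa : L.1 ≠ a)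
    (hLb : L.1 ≠ b)
    (u v : Fin n × Fin d) (hu : u ∈ A) (hv : v ∈ B) :
    phi L A B (E u v) = -1 := by
  rw [phi_E L A B a b hA hB hab hLa hLb]
  have hLA : L ∉ A := fun h => hLa (hA L h)
  have hLB : L ∉ B := fun h => hLb (hB L h)
  have hd : ∀ w ∈ A, w ∉ B := fun w h h' => hab ((hA w h).symm.trans (hB w h'))
  have key : ∀ C : Finset (Fin n × Fin d),
      (∑ w ∈ C, if (u = L ∧ v = w) ∨ (u = w ∧ v = L) then (1:ℝ) else 0) = 0 := by
    intro C
    exact Finset.sum_eq_zero fun w hw => if_neg (by grind)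
  rw [key, key]
  rw [Finset.sum_eq_single_of_mem u hu, Finset.sum_eq_single_of_mem v hv]
  · simp
  · intro q hq hqv
    exact if_neg (by grind)
  · intro p hp hpu
    exact Finset.sum_eq_zero fun q hq => if_neg (by grind)

lemma phi_E_zero
    {n d : ℕ} (L : Fin n × Fin d) (A B : Finset (Fin n × Fin d)) (a b : Fin n)
    (hA : ∀ u ∈ A, u.1 = a) (hB : ∀ u ∈ B, u.1 = b) (hab : a ≠ b) (hLa : L.1 ≠ a)
    (hLb : L.1 ≠ b)
    (u v : Fin n × Fin d) (h1 : ¬ (u = L ∧ (v ∈ A ∨ v ∈ B)))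
    (h2 : ¬ (v = L ∧ (u ∈ A ∨ u ∈ B))) (h3 : ¬ (u ∈ A ∧ v ∈ B)) (h4 : ¬ (v ∈ A ∧ u ∈ B)) :
    phi L A B (E u v) = 0 := by
  rw [phi_E L A B a b hA hB hab hLa hLb]
  rw [Finset.sum_eq_zero fun w hw => if_neg (by grind),
    Finset.sum_eq_zero fun w hw => if_neg (by grind),
    Finset.sum_eq_zero fun p hp => Finset.sum_eq_zero fun q hq => if_neg (by grind)]
  simp

lemma E_comm {n d : ℕ} (u v : Fin n × Fin d) : (E u v : JIdx n d → ℝ) = E v u := by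
  funext e
  simp only [E]
  congr 1
  grind

set_option maxHeartbeats 1000000 in
lemma face_span
    {n d : ℕ} (L : Fin n × Fin d) (A B : Finset (Fin n × Fin d)) (a b : Fin n)
    (hA : ∀ u ∈ A, u.1 = a) (hB : ∀ u ∈ B, u.1 = b) (hab : a ≠ b) (hLa : L.1 ≠ a)
    (hLb : L.1 ≠ b)
    (hAne : A.Nonempty) (hBne : B.Nonempty) :
    Module.finrank ℝ (vectorSpan ℝ {x ∈ jointMatchingPolytope n d | phi L A B x = 1}) =
      n.choose 2 * d ^ 2 - 1 := by
  set F := {x ∈ jointMatchingPolytope n d | phi L A B x = 1} with hF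
  obtain ⟨q0, hq0⟩ := hBne
  obtain ⟨t0, ht0⟩ := hAne
  have hLA : L ∉ A := fun h => hLa (hA L h)
  have hLB : L ∉ B := fun h => hLb (hB L h)
  have hd : ∀ w ∈ A, w ∉ B := fun w h h' => hab ((hA w h).symm.trans (hB w h'))
  have hL1 : ∀ w, w ∈ A ∨ w ∈ B → L.1 ≠ w.1 := by
    rintro w (h | h)
    · rw [hA w h]; exact hLa
    · rw [hB w h]; exact hLb
  have memF : ∀ x, IsConsistentVec n d x → phi L A B x = 1 → x ∈ F :=
    fun x hx h => ⟨subset_convexHull ℝ _ hx, h⟩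
  have pL := phi_E_L L A B a b hA hB hab hLa hLb
  have pC := phi_E_cross L A B a b hA hB hab hLa hLb
  have pZ := phi_E_zero L A B a b hA hB hab hLa hLb
  set p0 : JIdx n d → ℝ := E L q0 with hp0
  have p0F : p0 ∈ F := memF _ (cons_one _ _ (hL1 _ (Or.inr hq0))) (pL _ (Or.inr hq0))
  have sub : ∀ x ∈ F, ∀ y ∈ F, x - y ∈ vectorSpan ℝ F :=
    fun x hx y hy => vsub_mem_vectorSpan ℝ hx hy
  have ELF : ∀ v, v ∈ A ∨ v ∈ B → E L v ∈ F := fun v hv =>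
    memF _ (cons_one _ _ (hL1 _ hv)) (pL _ hv)
  -- step 2
  have s2 : ∀ u ∈ A, ∀ v ∈ B, E u v + p0 ∈ vectorSpan ℝ F := by
    intro u hu v hv
    have hT : E L u + E L v + E u v ∈ F := by
      refine memF _ (cons_three _ _ _ (hL1 _ (Or.inl hu)) (hL1 _ (Or.inr hv)) ?_) ?_
      · rw [hA u hu, hB v hv]; exact hab
      · rw [map_add, map_add, pL u (Or.inl hu), pL v (Or.inr hv), pC u v hu hv]; norm_num
    have := sub _ hT _ (ELF u (Or.inl hu))
    have h2 := sub_mem this (sub _ (ELF v (Or.inr hv)) _ p0F)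
    convert h2 using 1
    abel
  -- step 3
  have s3 : ∀ u v : Fin n × Fin d, u.1 ≠ v.1 → u ≠ L → v ≠ L → ¬ (u ∈ A ∧ v ∈ B) →
      ¬ (v ∈ A ∧ u ∈ B) → E u v ∈ vectorSpan ℝ F := by
    intro u v huv hu hv h1 h2
    obtain ⟨q, hq, hqu, hqv⟩ : ∃ q, (q ∈ A ∨ q ∈ B) ∧ u ≠ q ∧ v ≠ q := by
      by_contra hcon
      push Not at hcon
      have := hcon t0 (Or.inl ht0)
      have hq := hcon q0 (Or.inr hq0)
      clear sub ELF s2 pL pC pZ memF p0F hp0 p0 hF F hL1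
      have hne : t0 ≠ q0 := fun h => hd t0 ht0 (h ▸ hq0)
      by_cases c1 : u = t0
      · subst c1
        by_cases c2 : v = q0
        · subst c2; exact h1 ⟨ht0, hq0⟩
        · exact c2 (hq hne)
      · have c3 : v = t0 := by tauto
        subst c3
        by_cases c2 : u = q0
        · subst c2; exact h2 ⟨ht0, hq0⟩
        · exact hne (hq c2)
    have hT : E L q + E u v ∈ F := by
      refine memF _ (cons_two _ _ _ _ (hL1 _ hq) huv hu hqu hv hqv) ?_
      rw [map_add, pL q hq, pZ u v (by tauto) (by tauto) h1 h2]; norm_num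
    have := sub _ hT _ (ELF q hq)
    simpa using this
  -- step 4
  have s4 : ∀ v : Fin n × Fin d, L.1 ≠ v.1 → v ∉ A → v ∉ B → E L v ∈ vectorSpan ℝ F := by
    intro v hv h1 h2
    obtain ⟨q, hq, hqv⟩ : ∃ q, (q ∈ A ∨ q ∈ B) ∧ v.1 ≠ q.1 := by
      by_cases h : v.1 = a
      · exact ⟨q0, Or.inr hq0, by rw [hB q0 hq0, h]; exact hab⟩
      · exact ⟨t0, Or.inl ht0, by rw [hA t0 ht0]; exact h⟩
    have hvL : v ≠ L := fun h => hv (by rw [h])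
    have hqL : q ≠ L := fun h => hL1 q hq (by rw [h])
    have hT : E L v + E L q + E v q ∈ F := by
      refine memF _ (cons_three _ _ _ hv (hL1 _ hq) hqv) ?_
      rw [map_add, map_add, pL q hq, pZ L v (by tauto) (by tauto) (by tauto) (by tauto),
        pZ v q (by tauto) (by tauto) (by tauto) (by tauto)]
      norm_num
    have h3 := s3 v q hqv hvL hqL (by tauto) (by tauto)
    have := sub_mem (sub _ hT _ (ELF q hq)) h3
    convert this using 1
    abel
  have sL : ∀ v : Fin n × Fin d, L.1 ≠ v.1 →
      E L v - phi L A B (E L v) • p0 ∈ vectorSpan ℝ F := by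
    intro v hv
    by_cases h : v ∈ A ∨ v ∈ B
    · rw [pL v h, one_smul]; exact sub _ (ELF v h) _ p0F
    · have hvL : v ≠ L := fun h => hv (by rw [h])
      rw [pZ L v (by tauto) (by tauto) (by tauto) (by tauto), zero_smul, sub_zero]
      exact s4 v hv (by tauto) (by tauto)
  have sAll : ∀ u v : Fin n × Fin d, u.1 ≠ v.1 →
      E u v - phi L A B (E u v) • p0 ∈ vectorSpan ℝ F := by
    intro u v huv
    by_cases hu : u = L
    · subst hu; exact sL v huv
    by_cases hv : v = L
    · subst hv; rw [E_comm]; exact sL u huv.symm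
    by_cases h1 : u ∈ A ∧ v ∈ B
    · rw [pC u v h1.1 h1.2]; simpa using s2 u h1.1 v h1.2
    by_cases h2 : v ∈ A ∧ u ∈ B
    · rw [E_comm, pC v u h2.1 h2.2]; simpa using s2 v h2.1 u h2.2
    rw [pZ u v (by tauto) (by tauto) h1 h2, zero_smul, sub_zero]
    exact s3 u v huv hu hv h1 h2
  have hker : vectorSpan ℝ F = LinearMap.ker (phi L A B) := by
    apply le_antisymm
    · rw [vectorSpan_def, Submodule.span_le]
      rintro _ ⟨x, hx, y, hy, rfl⟩
      simp only [SetLike.mem_coe, LinearMap.mem_ker, vsub_eq_sub, map_sub]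
      rw [hx.2, hy.2, sub_self]
    · intro x hx
      rw [LinearMap.mem_ker] at hx
      have hE : ∀ f : JIdx n d, (Pi.single f (1:ℝ) : JIdx n d → ℝ) = E (src f) (tgt f) := by
        intro f
        funext e
        have h1 : src e ≠ tgt f ∨ tgt e ≠ src f := by
          by_contra hcon
          push Not at hcon
          have h3 : (src e).1 < (tgt e).1 := e.1.2
          have h4 : (src f).1 < (tgt f).1 := f.1.2
          rw [hcon.1, hcon.2] at h3
          exact absurd h3 h4.le.not_gt
        have h2 : src f = src e ∧ tgt f = tgt e ↔ e = f := by
          constructor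
          · rintro ⟨h3, h4⟩
            obtain ⟨⟨⟨e1, e2⟩, e3⟩, e4, e5⟩ := e
            obtain ⟨⟨⟨f1, f2⟩, f3⟩, f4, f5⟩ := f
            simp only [src, tgt, Prod.mk.injEq] at h3 h4
            obtain ⟨rfl, rfl⟩ := h3
            obtain ⟨rfl, rfl⟩ := h4
            rfl
          · rintro rfl; simp
        simp only [E, Pi.single_apply]
        congr 1
        rw [← h2]
        apply propext
        clear hx
        constructor
        · exact Or.inl
        · rintro (h3 | ⟨h3, h4⟩)
          · exact h3
          · rcases h1 with h1 | h1
            · exact absurd h4.symm h1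
            · exact absurd h3.symm h1
      have hx2 : x = ∑ f, x f • E (src f) (tgt f) := by
        conv_lhs => rw [pi_eq_sum_univ' x]
        refine Finset.sum_congr rfl fun f _ => ?_
        rw [← hE]
      have hx3 : x = ∑ f, x f • (E (src f) (tgt f) - phi L A B (E (src f) (tgt f)) • p0) := by
        simp only [smul_sub, Finset.sum_sub_distrib]
        rw [← hx2]
        have : ∑ f, x f • phi L A B (E (src f) (tgt f)) • p0 = (phi L A B x) • p0 := by
          conv_rhs => rw [hx2]
          simp only [map_sum, map_smul, Finset.sum_smul, smul_eq_mul, mul_smul]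
        rw [this, hx, zero_smul, sub_zero]
      rw [hx3]
      exact Submodule.sum_mem _ fun f _ => Submodule.smul_mem _ _ (sAll _ _ (src_ne_tgt f))
  rw [hker]
  have hsurj : Function.Surjective (phi L A B) := by
    intro r
    exact ⟨r • p0, by rw [map_smul, p0F.2, smul_eq_mul, mul_one]⟩
  have hrn := LinearMap.finrank_range_add_finrank_ker (phi L A B)
  rw [LinearMap.range_eq_top.mpr hsurj, finrank_top, Module.finrank_self,
    Module.finrank_fintype_fun_eq_card, card_JIdx] at hrn
  omega

lemma S_bin {n d : ℕ} {x : JIdx n d → ℝ} (hx : IsConsistentVec n d x) (u v : Fin n × Fin d) :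
    S u v x = 0 ∨ S u v x = 1 := by
  simp only [S]
  split_ifs
  · exact hx.1 _ _ _
  · exact hx.1 _ _ _
  · simp

lemma S_row {n d : ℕ} {x : JIdx n d → ℝ} (hx : IsConsistentVec n d x) (u : Fin n × Fin d) (b : Fin n)
    (h : u.1 ≠ b) : ∑ q : Fin d, S u (b, q) x ≤ 1 := by
  obtain ⟨i, s⟩ := u
  rcases lt_or_gt_of_ne h with h | h
  · simp only [S_of_lt h]; exact hx.2.1 _ _
  · simp only [S_of_gt h]; exact hx.2.2.1 _ _

lemma S_tri {n d : ℕ} {x : JIdx n d → ℝ} (hx : IsConsistentVec n d x) (u v w : Fin n × Fin d)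
    (h1 : u.1 ≠ v.1) (h2 : u.1 ≠ w.1) (h3 : v.1 ≠ w.1) :
    S u v x + S u w x - S v w x ≤ 1 := by
  obtain ⟨i, s⟩ := u
  obtain ⟨j, t⟩ := v
  obtain ⟨k, r⟩ := w
  have T := hx.2.2.2
  rcases lt_or_gt_of_ne h1 with h1 | h1 <;> rcases lt_or_gt_of_ne h2 with h2 | h2 <;>
    rcases lt_or_gt_of_ne h3 with h3 | h3 <;>
    simp only [S_of_lt, S_of_gt, h1, h2, h3]
  · have := T i j k h1 h3 s t r; linarith
  · have := T i k j h2 h3 s r t; linarith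
  · exact absurd (h1.trans h3) h2.not_gt
  · have := T k i j h2 h1 r s t; linarith
  · have := T j i k h1 h2 t s r; linarith
  · exact absurd (h3.trans h1) h2.not_gt
  · have := T j k i h3 h2 t r s; linarith
  · have := T k j i h3 h1 r t s; linarith

lemma S_sum {n d : ℕ} (L : Fin n × Fin d) {x : JIdx n d → ℝ} (hx : IsConsistentVec n d x) (b : Fin n)
    (C : Finset (Fin n × Fin d)) (hC : ∀ u ∈ C, u.1 = b) (h : L.1 ≠ b) :
    ∑ v ∈ C, S L v x ≤ 1 := by
  refine le_trans ?_ (S_row hx L b h)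
  have : ∑ q : Fin d, S L (b, q) x = ∑ v ∈ ({b} : Finset (Fin n)) ×ˢ (Finset.univ : Finset (Fin d)), S L v x := by
    rw [Finset.sum_product, Finset.sum_singleton]
  rw [this]
  refine Finset.sum_le_sum_of_subset_of_nonneg ?_ ?_
  · intro v hv
    rw [Finset.mem_product, Finset.mem_singleton]
    exact ⟨hC v hv, Finset.mem_univ _⟩
  · intro v _ _
    rcases S_bin hx L v with h | h <;> rw [h] <;> norm_num

lemma valid
    {n d : ℕ} (L : Fin n × Fin d) (A B : Finset (Fin n × Fin d)) (a b : Fin n)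
    (hA : ∀ u ∈ A, u.1 = a) (hB : ∀ u ∈ B, u.1 = b) (hab : a ≠ b) (hLa : L.1 ≠ a)
    (hLb : L.1 ≠ b)
    (x : JIdx n d → ℝ) (hx : x ∈ jointMatchingPolytope n d) : phi L A B x ≤ 1 := by
  have hconv : Convex ℝ {x | phi L A B x ≤ 1} := convex_halfSpace_le (phi L A B).isLinear 1
  refine convexHull_min ?_ hconv hx
  intro y hy
  change phi L A B y ≤ 1
  rw [phi_apply]
  have ha := S_sum L hy a A hA hLa
  have hb := S_sum L hy b B hB hLb
  have hm : (∑ u ∈ A, S L u y) * (∑ v ∈ B, S L v y) ≤ ∑ u ∈ A, ∑ v ∈ B, S u v y := by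
    rw [Finset.sum_mul_sum]
    refine Finset.sum_le_sum fun u hu => Finset.sum_le_sum fun v hv => ?_
    have := S_tri hy L u v (by rw [hA u hu]; exact hLa) (by rw [hB v hv]; exact hLb)
      (by rw [hA u hu, hB v hv]; exact hab)
    rcases S_bin hy L u with h | h <;> rcases S_bin hy L v with h' | h' <;>
      rcases S_bin hy u v with h'' | h'' <;> rw [h, h', h''] at this <;> rw [h, h', h''] <;> linarith
  nlinarith [mul_nonneg (sub_nonneg.mpr ha) (sub_nonneg.mpr hb)]

lemma main {n d : ℕ} (D1 D2 : Finset (Fin d)) (hD1 : D1.Nonempty) (hD2 : D2.Nonempty) (l : Fin d)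
    (a b c : Fin n) (hab : a ≠ b) (hca : c ≠ a) (hcb : c ≠ b)
    (f : (JIdx n d → ℝ) → ℝ)
    (hf : ∀ x, f x = ∑ q ∈ D2, S (c, l) (b, q) x + ∑ t ∈ D1, S (c, l) (a, t) x
      - ∑ t ∈ D1, ∑ q ∈ D2, S (a, t) (b, q) x) :
    (∀ x ∈ jointMatchingPolytope n d, f x ≤ 1) ∧
    Module.finrank ℝ (vectorSpan ℝ {x ∈ jointMatchingPolytope n d | f x = 1}) =
      n.choose 2 * d ^ 2 - 1 := by
  have hfe : f = phi (c, l) ({a} ×ˢ D1) ({b} ×ˢ D2) := by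
    funext x
    rw [hf, phi_apply]
    simp only [Finset.sum_product, Finset.sum_singleton]
  have hA : ∀ u ∈ ({a} : Finset (Fin n)) ×ˢ D1, u.1 = a := by
    intro u hu; exact Finset.mem_singleton.mp (Finset.mem_product.mp hu).1
  have hB : ∀ u ∈ ({b} : Finset (Fin n)) ×ˢ D2, u.1 = b := by
    intro u hu; exact Finset.mem_singleton.mp (Finset.mem_product.mp hu).1
  rw [hfe]
  exact ⟨valid (c, l) _ _ a b hA hB hab hca hcb,
    face_span (c, l) _ _ a b hA hB hab hca hcb
      ((Finset.singleton_nonempty a).product hD1) ((Finset.singleton_nonempty b).product hD2)⟩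

end JMP

/-- Every consistency inequality is facet-defining for the joint matching polytope:
each of the three families is valid, and the corresponding face has affine dimension
`(n choose 2) * d ^ 2 - 1`. -/
theorem consistency_inequalities_facet_defining (n d : ℕ) (hn : 3 ≤ n) (hd : 2 ≤ d)
    (D1 D2 : Finset (Fin d)) (hD1 : D1.Nonempty) (hD2 : D2.Nonempty) (l : Fin d)
    (i j k : Fin n) (hij : i < j) (hjk : j < k) :
    ((∀ x ∈ jointMatchingPolytope n d,
        -∑ t ∈ D1, ∑ q ∈ D2, x (⟨(i, j), hij⟩, (t, q))
          + ∑ q ∈ D2, x (⟨(j, k), hjk⟩, (q, l))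
          + ∑ t ∈ D1, x (⟨(i, k), lt_trans hij hjk⟩, (t, l)) ≤ 1) ∧
      Module.finrank ℝ
          ↥(vectorSpan ℝ {x ∈ jointMatchingPolytope n d |
              -∑ t ∈ D1, ∑ q ∈ D2, x (⟨(i, j), hij⟩, (t, q))
                + ∑ q ∈ D2, x (⟨(j, k), hjk⟩, (q, l))
                + ∑ t ∈ D1, x (⟨(i, k), lt_trans hij hjk⟩, (t, l)) = 1}) =
        n.choose 2 * d ^ 2 - 1) ∧
    ((∀ x ∈ jointMatchingPolytope n d,
        ∑ t ∈ D1, x (⟨(i, j), hij⟩, (l, t))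
          - ∑ t ∈ D1, ∑ q ∈ D2, x (⟨(j, k), hjk⟩, (t, q))
          + ∑ q ∈ D2, x (⟨(i, k), lt_trans hij hjk⟩, (l, q)) ≤ 1) ∧
      Module.finrank ℝ
          ↥(vectorSpan ℝ {x ∈ jointMatchingPolytope n d |
              ∑ t ∈ D1, x (⟨(i, j), hij⟩, (l, t))
                - ∑ t ∈ D1, ∑ q ∈ D2, x (⟨(j, k), hjk⟩, (t, q))
                + ∑ q ∈ D2, x (⟨(i, k), lt_trans hij hjk⟩, (l, q)) = 1}) =
        n.choose 2 * d ^ 2 - 1) ∧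
    ((∀ x ∈ jointMatchingPolytope n d,
        ∑ t ∈ D1, x (⟨(i, j), hij⟩, (t, l))
          + ∑ q ∈ D2, x (⟨(j, k), hjk⟩, (l, q))
          - ∑ t ∈ D1, ∑ q ∈ D2, x (⟨(i, k), lt_trans hij hjk⟩, (t, q)) ≤ 1) ∧
      Module.finrank ℝ
          ↥(vectorSpan ℝ {x ∈ jointMatchingPolytope n d |
              ∑ t ∈ D1, x (⟨(i, j), hij⟩, (t, l))
                + ∑ q ∈ D2, x (⟨(j, k), hjk⟩, (l, q))
                - ∑ t ∈ D1, ∑ q ∈ D2, x (⟨(i, k), lt_trans hij hjk⟩, (t, q)) = 1}) =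
        n.choose 2 * d ^ 2 - 1) := by
  have hik := lt_trans hij hjk
  refine ⟨?_, ?_, ?_⟩
  · refine JMP.main D1 D2 hD1 hD2 l i j k hij.ne hik.ne' hjk.ne' (fun x => _) fun x => ?_
    simp only [JMP.S_of_lt hij, JMP.S_of_gt hjk, JMP.S_of_gt hik]
    ring
  · refine JMP.main D1 D2 hD1 hD2 l j k i hjk.ne hij.ne hik.ne (fun x => _) fun x => ?_
    simp only [JMP.S_of_lt hij, JMP.S_of_lt hjk, JMP.S_of_lt hik]
    ring
  · refine JMP.main D1 D2 hD1 hD2 l i k j hik.ne hij.ne' hjk.ne (fun x => _) fun x => ?_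
    simp only [JMP.S_of_gt hij, JMP.S_of_lt hjk, JMP.S_of_lt hik]
    ring
end

section
/- For all n ≥ 3 and d ≥ 2, every block consistency inequality with |D1| + |D2| > |D3| is facet-defining for the joint matching polytope C_{n,d}: for all nonempty D1, D2, D3 ⊆ [d] with |D1| + |D2| > |D3| and all 1 ≤ i < j < k ≤ n, each of the three block consistency inequalities (e.g. Σ_{l∈D3}(Σ_{t∈D1} X_{lt}(i,j) + Σ_{q∈D2} X_{lq}(i,k)) − Σ_{t∈D1}Σ_{q∈D2} X_{tq}(j,k) ≤ |D3|, and its two analogues obtained by permuting the roles of the three objects) is valid for C_{n,d} and the face on which it holds with equality has affine dimension (n choose 2)d² − 1. -/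
namespace JMP

open Finset

/-- Symmetrized coordinate functional. -/
noncomputable def yL {n d : ℕ} (p r : Fin n × Fin d) : (JIdx n d → ℝ) →ₗ[ℝ] ℝ :=
  if h : p.1 < r.1 then LinearMap.proj (⟨(p.1, r.1), h⟩, (p.2, r.2))
  else if h : r.1 < p.1 then LinearMap.proj (⟨(r.1, p.1), h⟩, (r.2, p.2))
  else 0

/-- The vector of a labeling. -/
noncomputable def vec {n d : ℕ} (F : Fin n × Fin d → Fin n × Fin d) : JIdx n d → ℝ :=
  fun z => if F (z.1.1.1, z.2.1) = F (z.1.1.2, z.2.2) then 1 else 0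

/-- Symmetrized unit vector. -/
noncomputable def ev {n d : ℕ} (p r : Fin n × Fin d) : JIdx n d → ℝ :=
  fun z => if ((z.1.1.1, z.2.1) = p ∧ (z.1.1.2, z.2.2) = r) ∨
    ((z.1.1.1, z.2.1) = r ∧ (z.1.1.2, z.2.2) = p) then 1 else 0

theorem ev_symm {n d : ℕ} (p r : Fin n × Fin d) : ev p r = ev r p := by
  funext z; simp only [ev]; congr 1; rw [or_comm]

/-- The block functional with centre `a`. -/
noncomputable def blk {n d : ℕ} (a b c : Fin n) (D1 D2 D3 : Finset (Fin d)) :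
    (JIdx n d → ℝ) →ₗ[ℝ] ℝ :=
  ∑ l ∈ D3, ∑ t ∈ D1, yL (a, l) (b, t) + ∑ l ∈ D3, ∑ q ∈ D2, yL (a, l) (c, q)
    - ∑ t ∈ D1, ∑ q ∈ D2, yL (b, t) (c, q)

theorem blk_apply {n d : ℕ} (a b c : Fin n) (D1 D2 D3 : Finset (Fin d)) (x : JIdx n d → ℝ) :
    blk a b c D1 D2 D3 x =
    ∑ l ∈ D3, ∑ t ∈ D1, yL (a, l) (b, t) x + ∑ l ∈ D3, ∑ q ∈ D2, yL (a, l) (c, q) x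
    - ∑ t ∈ D1, ∑ q ∈ D2, yL (b, t) (c, q) x := by
  simp [blk, LinearMap.sum_apply]

section real
variable {d : ℕ} (X Y Z : Fin d → Fin d → ℝ) (D1 D2 D3 : Finset (Fin d))

theorem real_identity :
    ∑ l ∈ D3, ∑ t ∈ D1, X l t + ∑ l ∈ D3, ∑ q ∈ D2, Y l q - ∑ t ∈ D1, ∑ q ∈ D2, Z t q
    = D3.card - ∑ l ∈ D3, (1 - ∑ t ∈ D1, X l t) * (1 - ∑ q ∈ D2, Y l q)
      - ∑ t ∈ D1, ∑ q ∈ D2, (Z t q - ∑ l ∈ D3, X l t * Y l q) := by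
  have h : ∑ t ∈ D1, ∑ q ∈ D2, ∑ l ∈ D3, X l t * Y l q
      = ∑ l ∈ D3, (∑ t ∈ D1, X l t) * (∑ q ∈ D2, Y l q) := by
    simp_rw [Finset.sum_mul_sum]
    rw [Finset.sum_comm (s := D3) (t := D1)]
    refine Finset.sum_congr rfl fun t _ => ?_
    rw [Finset.sum_comm]
  have h2 : ∀ l, (1 - ∑ t ∈ D1, X l t) * (1 - ∑ q ∈ D2, Y l q) =
      1 - ∑ t ∈ D1, X l t - ∑ q ∈ D2, Y l q + (∑ t ∈ D1, X l t) * (∑ q ∈ D2, Y l q) := by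
    intro l; ring
  simp only [h2, Finset.sum_sub_distrib, Finset.sum_add_distrib, h]
  simp only [Finset.sum_const, nsmul_eq_mul, mul_one]
  ring

theorem real_valid (hX : ∀ l t, X l t = 0 ∨ X l t = 1) (hY : ∀ l t, Y l t = 0 ∨ Y l t = 1)
  (hZ : ∀ l t, Z l t = 0 ∨ Z l t = 1)
  (rX : ∀ l, ∑ t, X l t ≤ 1) (rY : ∀ l, ∑ t, Y l t ≤ 1) (cX : ∀ t, ∑ l, X l t ≤ 1)
  (tri : ∀ l t q, X l t + Y l q - Z t q ≤ 1) :
    ∑ l ∈ D3, ∑ t ∈ D1, X l t + ∑ l ∈ D3, ∑ q ∈ D2, Y l q - ∑ t ∈ D1, ∑ q ∈ D2, Z t q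
    ≤ D3.card := by
  have X0 : ∀ l t, 0 ≤ X l t := fun l t => by rcases hX l t with h | h <;> simp [h]
  have Y0 : ∀ l t, 0 ≤ Y l t := fun l t => by rcases hY l t with h | h <;> simp [h]
  have sX : ∀ l, ∑ t ∈ D1, X l t ≤ 1 := fun l =>
    (Finset.sum_le_univ_sum_of_nonneg (fun t => X0 l t)).trans (rX l)
  have sY : ∀ l, ∑ t ∈ D2, Y l t ≤ 1 := fun l =>
    (Finset.sum_le_univ_sum_of_nonneg (fun t => Y0 l t)).trans (rY l)
  rw [real_identity]
  have h1 : 0 ≤ ∑ l ∈ D3, (1 - ∑ t ∈ D1, X l t) * (1 - ∑ q ∈ D2, Y l q) :=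
    Finset.sum_nonneg fun l _ => mul_nonneg (by linarith [sX l]) (by linarith [sY l])
  have h2 : 0 ≤ ∑ t ∈ D1, ∑ q ∈ D2, (Z t q - ∑ l ∈ D3, X l t * Y l q) := by
    refine Finset.sum_nonneg fun t _ => Finset.sum_nonneg fun q _ => ?_
    rcases hZ t q with h | h
    · have : ∑ l ∈ D3, X l t * Y l q = 0 := by
        refine Finset.sum_eq_zero fun l _ => ?_
        have := tri l t q
        rcases hX l t with h1 | h1 <;> rcases hY l q with h2 | h2 <;> simp [h1, h2]
        rw [h, h1, h2] at this; norm_num at this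
      rw [this, h]; simp
    · have : ∑ l ∈ D3, X l t * Y l q ≤ ∑ l, X l t := by
        refine le_trans (Finset.sum_le_sum (g := fun l => X l t) fun l _ => ?_)
          (Finset.sum_le_univ_sum_of_nonneg (fun l => X0 l t))
        rcases hY l q with h2 | h2 <;> simp [h2, X0]
      linarith [cX t]
  linarith

theorem real_tight (hX : ∀ l t, X l t = 0 ∨ X l t = 1) (hY : ∀ l t, Y l t = 0 ∨ Y l t = 1)
  (hZ : ∀ l t, Z l t = 0 ∨ Z l t = 1)
  (rX : ∀ l, ∑ t, X l t ≤ 1) (rY : ∀ l, ∑ t, Y l t ≤ 1) (cX : ∀ t, ∑ l, X l t ≤ 1)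
  (tri : ∀ l t q, X l t + Y l q - Z t q ≤ 1)
    (c1 : ∀ l ∈ D3, (∃ t ∈ D1, X l t = 1) ∨ (∃ q ∈ D2, Y l q = 1))
    (c2 : ∀ t ∈ D1, ∀ q ∈ D2, Z t q = 1 → ∃ l ∈ D3, X l t = 1 ∧ Y l q = 1) :
    ∑ l ∈ D3, ∑ t ∈ D1, X l t + ∑ l ∈ D3, ∑ q ∈ D2, Y l q - ∑ t ∈ D1, ∑ q ∈ D2, Z t q
    = D3.card := by
  refine le_antisymm (real_valid X Y Z D1 D2 D3 hX hY hZ rX rY cX tri) ?_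
  have X0 : ∀ l t, 0 ≤ X l t := fun l t => by rcases hX l t with h | h <;> simp [h]
  have Y0 : ∀ l t, 0 ≤ Y l t := fun l t => by rcases hY l t with h | h <;> simp [h]
  have sX : ∀ l, ∑ t ∈ D1, X l t ≤ 1 := fun l =>
    (Finset.sum_le_univ_sum_of_nonneg (fun t => X0 l t)).trans (rX l)
  have sY : ∀ l, ∑ t ∈ D2, Y l t ≤ 1 := fun l =>
    (Finset.sum_le_univ_sum_of_nonneg (fun t => Y0 l t)).trans (rY l)
  rw [real_identity]
  have h1 : ∑ l ∈ D3, (1 - ∑ t ∈ D1, X l t) * (1 - ∑ q ∈ D2, Y l q) = 0 := by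
    refine Finset.sum_eq_zero fun l hl => ?_
    rcases c1 l hl with ⟨t, ht, h⟩ | ⟨t, ht, h⟩
    · have := Finset.single_le_sum (fun t _ => X0 l t) ht
      rw [le_antisymm (sX l) (h ▸ this)]; simp
    · have := Finset.single_le_sum (fun t _ => Y0 l t) ht
      rw [le_antisymm (sY l) (h ▸ this)]; simp
  have h2 : ∑ t ∈ D1, ∑ q ∈ D2, (Z t q - ∑ l ∈ D3, X l t * Y l q) ≤ 0 := by
    refine Finset.sum_nonpos fun t ht => Finset.sum_nonpos fun q hq => ?_
    rcases hZ t q with h | h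
    · have : 0 ≤ ∑ l ∈ D3, X l t * Y l q :=
        Finset.sum_nonneg fun l _ => mul_nonneg (X0 _ _) (Y0 _ _)
      linarith
    · obtain ⟨l, hl, h1, h2⟩ := c2 t ht q hq h
      have := Finset.single_le_sum (f := fun l => X l t * Y l q)
        (fun l _ => mul_nonneg (X0 _ _) (Y0 _ _)) hl
      simp only [h1, h2] at this
      linarith
  linarith

end real

section cons
variable {n d : ℕ}

theorem yL_lt {p r : Fin n × Fin d} (h : p.1 < r.1) (x : JIdx n d → ℝ) :
    yL p r x = x (⟨(p.1, r.1), h⟩, (p.2, r.2)) := by simp [yL, h]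

theorem yL_gt {p r : Fin n × Fin d} (h : r.1 < p.1) (x : JIdx n d → ℝ) :
    yL p r x = x (⟨(r.1, p.1), h⟩, (r.2, p.2)) := by simp [yL, h, h.not_gt]

theorem cons_bin {x : JIdx n d → ℝ} (hx : IsConsistentVec n d x) (p r : Fin n × Fin d) :
    yL p r x = 0 ∨ yL p r x = 1 := by
  rcases lt_trichotomy p.1 r.1 with h | h | h
  · rw [yL_lt h]; exact hx.1 _ _ _
  · left; simp [yL, h]
  · rw [yL_gt h]; exact hx.1 _ _ _

theorem cons_row {x : JIdx n d → ℝ} (hx : IsConsistentVec n d x) {a b : Fin n} (hab : a ≠ b)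
    (l : Fin d) : ∑ t, yL (a, l) (b, t) x ≤ 1 := by
  rcases lt_or_gt_of_ne hab with h | h
  · simp_rw [yL_lt (p := (a, l)) (r := (b, _)) h]; exact hx.2.1 _ _
  · simp_rw [yL_gt (p := (a, l)) (r := (b, _)) h]; exact hx.2.2.1 _ _

theorem cons_col {x : JIdx n d → ℝ} (hx : IsConsistentVec n d x) {a b : Fin n} (hab : a ≠ b)
    (t : Fin d) : ∑ l, yL (a, l) (b, t) x ≤ 1 := by
  rcases lt_or_gt_of_ne hab with h | h
  · simp_rw [yL_lt (p := (a, _)) (r := (b, t)) h]; exact hx.2.2.1 _ _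
  · simp_rw [yL_gt (p := (a, _)) (r := (b, t)) h]; exact hx.2.1 _ _

theorem cons_tri {x : JIdx n d → ℝ} (hx : IsConsistentVec n d x) {a b c : Fin n} (hab : a ≠ b)
    (hac : a ≠ c) (hbc : b ≠ c) (l t q : Fin d) :
    yL (a, l) (b, t) x + yL (a, l) (c, q) x - yL (b, t) (c, q) x ≤ 1 := by
  have H := hx.2.2.2
  rcases lt_or_gt_of_ne hab with h1 | h1 <;> rcases lt_or_gt_of_ne hac with h2 | h2 <;>
    rcases lt_or_gt_of_ne hbc with h3 | h3
  · rw [yL_lt h1, yL_lt h2, yL_lt h3]; linarith [(H a b c h1 h3 l t q).2.1]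
  · rw [yL_lt h1, yL_lt h2, yL_gt h3]; linarith [(H a c b h2 h3 l q t).2.1]
  · exact absurd (h1.trans h3) h2.not_gt
  · rw [yL_lt h1, yL_gt h2, yL_gt h3]; linarith [(H c a b h2 h1 q l t).2.2]
  · rw [yL_gt h1, yL_lt h2, yL_lt h3]; linarith [(H b a c h1 h2 t l q).2.2]
  · exact absurd (h2.trans h3) h1.not_gt
  · rw [yL_gt h1, yL_gt h2, yL_lt h3]; linarith [(H b c a h3 h2 t q l).1]
  · rw [yL_gt h1, yL_gt h2, yL_gt h3]; linarith [(H c b a h3 h1 q t l).1]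

theorem blk_valid_cons {x : JIdx n d → ℝ} (hx : IsConsistentVec n d x) {a b c : Fin n}
    (hab : a ≠ b) (hac : a ≠ c) (hbc : b ≠ c) (D1 D2 D3 : Finset (Fin d)) :
    blk a b c D1 D2 D3 x ≤ D3.card := by
  rw [blk_apply]
  exact real_valid (fun l t => yL (a, l) (b, t) x) (fun l t => yL (a, l) (c, t) x)
    (fun l t => yL (b, l) (c, t) x) D1 D2 D3 (fun _ _ => cons_bin hx _ _)
    (fun _ _ => cons_bin hx _ _) (fun _ _ => cons_bin hx _ _) (fun _ => cons_row hx hab _)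
    (fun _ => cons_row hx hac _) (fun _ => cons_col hx hab _)
    (fun _ _ _ => cons_tri hx hab hac hbc _ _ _)

theorem blk_valid {a b c : Fin n}
    (hab : a ≠ b) (hac : a ≠ c) (hbc : b ≠ c) (D1 D2 D3 : Finset (Fin d))
    {x : JIdx n d → ℝ} (hx : x ∈ jointMatchingPolytope n d) :
    blk a b c D1 D2 D3 x ≤ D3.card := by
  have hc : Convex ℝ {x | blk a b c D1 D2 D3 x ≤ D3.card} :=
    convex_halfSpace_le (LinearMap.isLinear _) _
  exact convexHull_min (fun y hy => blk_valid_cons hy hab hac hbc D1 D2 D3) hc hx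

/-- Labels injective on each object. -/
def ObjInj (F : Fin n × Fin d → Fin n × Fin d) : Prop :=
  ∀ a l t, F (a, l) = F (a, t) → l = t

theorem sum_ite_le_one {P : Fin d → Prop} [DecidablePred P] (h : ∀ s t, P s → P t → s = t) :
    ∑ t, (if P t then (1 : ℝ) else 0) ≤ 1 := by
  rw [Finset.sum_boole]
  norm_cast
  rw [Finset.card_le_one]
  intro s hs t ht
  simp at hs ht
  exact h s t hs ht

theorem vec_cons {F : Fin n × Fin d → Fin n × Fin d} (hF : ObjInj F) :
    IsConsistentVec n d (vec F) := by
  refine ⟨?_, ?_, ?_, ?_⟩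
  · intro e t q; simp only [vec]; split_ifs <;> simp
  · intro e t; exact sum_ite_le_one fun s t h1 h2 => hF _ _ _ (h1.symm.trans h2)
  · intro e t; exact sum_ite_le_one fun s t h1 h2 => hF _ _ _ (h1.trans h2.symm)
  · intro i j k hij hjk l t q
    simp only [vec]
    refine ⟨?_, ?_, ?_⟩ <;> split_ifs <;> first | (exfalso; grind) | norm_num

theorem yL_vec (F : Fin n × Fin d → Fin n × Fin d) {p r : Fin n × Fin d} (h : p.1 ≠ r.1) :
    yL p r (vec F) = if F p = F r then 1 else 0 := by
  rcases lt_or_gt_of_ne h with h | h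
  · rw [yL_lt h]; simp [vec]
  · rw [yL_gt h]; simp [vec, eq_comm]

/-- Allowed partners of the centre. -/
def TT (b c : Fin n) (D1 D2 : Finset (Fin d)) : Finset (Fin n × Fin d) :=
  ({b} ×ˢ D1) ∪ ({c} ×ˢ D2)

theorem mem_TT {b c : Fin n} {D1 D2 : Finset (Fin d)} {u : Fin n × Fin d} :
    u ∈ TT b c D1 D2 ↔ (u.1 = b ∧ u.2 ∈ D1) ∨ (u.1 = c ∧ u.2 ∈ D2) := by
  simp only [TT, Finset.mem_union, Finset.mem_product, Finset.mem_singleton]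

theorem card_TT {b c : Fin n} (h : b ≠ c) (D1 D2 : Finset (Fin d)) :
    (TT b c D1 D2).card = D1.card + D2.card := by
  rw [TT, Finset.card_union_of_disjoint]
  · simp
  · rw [Finset.disjoint_left]
    rintro ⟨u, v⟩ h1 h2
    simp only [Finset.mem_product, Finset.mem_singleton] at h1 h2
    exact h (h1.1.symm.trans h2.1)

/-- The face. -/
def face (a b c : Fin n) (D1 D2 D3 : Finset (Fin d)) : Set (JIdx n d → ℝ) :=
  {x ∈ jointMatchingPolytope n d | blk a b c D1 D2 D3 x = D3.card}

theorem vec_mem_face {a b c : Fin n} (hab : a ≠ b) (hac : a ≠ c) (hbc : b ≠ c)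
    {D1 D2 D3 : Finset (Fin d)} {F : Fin n × Fin d → Fin n × Fin d} (hF : ObjInj F)
    (c1 : ∀ l ∈ D3, ∃ u ∈ TT b c D1 D2, F (a, l) = F u)
    (c2 : ∀ u ∈ TT b c D1 D2, ∀ v ∈ TT b c D1 D2, u.1 ≠ v.1 → F u = F v →
      ∃ l ∈ D3, F (a, l) = F u) :
    vec F ∈ face a b c D1 D2 D3 := by
  have hx := vec_cons hF
  refine ⟨subset_convexHull ℝ _ hx, ?_⟩
  rw [blk_apply]
  refine real_tight (fun l t => yL (a, l) (b, t) (vec F)) (fun l t => yL (a, l) (c, t) (vec F))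
    (fun l t => yL (b, l) (c, t) (vec F)) D1 D2 D3 (fun _ _ => cons_bin hx _ _)
    (fun _ _ => cons_bin hx _ _) (fun _ _ => cons_bin hx _ _) (fun _ => cons_row hx hab _)
    (fun _ => cons_row hx hac _) (fun _ => cons_col hx hab _)
    (fun _ _ _ => cons_tri hx hab hac hbc _ _ _) ?_ ?_
  · intro l hl
    obtain ⟨⟨u1, u2⟩, hu, h⟩ := c1 l hl
    rcases mem_TT.1 hu with ⟨h1, h2⟩ | ⟨h1, h2⟩
    · left
      simp only at h1 h2
      subst h1
      exact ⟨u2, h2, by rw [yL_vec F hab, if_pos h]⟩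
    · right
      simp only at h1 h2
      subst h1
      exact ⟨u2, h2, by rw [yL_vec F hac, if_pos h]⟩
  · intro t ht q hq h
    simp only [yL_vec F (p := (b, t)) (r := (c, q)) hbc] at h
    have h' : F (b, t) = F (c, q) := by by_contra h'; simp [h'] at h
    obtain ⟨l, hl, h2⟩ := c2 (b, t) (mem_TT.2 (Or.inl ⟨rfl, ht⟩)) (c, q)
      (mem_TT.2 (Or.inr ⟨rfl, hq⟩)) hbc h'
    exact ⟨l, hl, by rw [yL_vec F hab, if_pos h2],
      by rw [yL_vec F hac, if_pos (h2.trans h')]⟩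

end cons

section moves
variable {n d : ℕ} {a b c : Fin n} {D1 D2 D3 : Finset (Fin d)}

theorem exists_m (hbc : b ≠ c) (hD1 : D1.Nonempty) (hcard : D3.card < D1.card + D2.card)
    (s : Fin n × Fin d) :
    ∃ m : Fin d → Fin n × Fin d, (∀ l ∈ D3, ∀ l' ∈ D3, m l = m l' → l = l') ∧
      (∀ l ∈ D3, m l ∈ TT b c D1 D2) ∧ ∀ l ∈ D3, m l ≠ s := by
  have hle : D3.card ≤ ((TT b c D1 D2).erase s).card := by
    have := Finset.pred_card_le_card_erase (s := TT b c D1 D2) (a := s)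
    rw [card_TT hbc] at this
    omega
  have hc : Fintype.card D3 ≤ Fintype.card ((TT b c D1 D2).erase s) := by
    simpa only [Fintype.card_coe] using hle
  obtain ⟨f⟩ := Function.Embedding.nonempty_of_card_le hc
  refine ⟨fun l => if h : l ∈ D3 then (f ⟨l, h⟩ : Fin n × Fin d) else s, ?_, ?_, ?_⟩
  · intro l hl l' hl' h
    simp only [hl, hl', dif_pos] at h
    simpa using f.injective (Subtype.ext h)
  · intro l hl
    simp only [hl, dif_pos]
    exact Finset.mem_of_mem_erase (f ⟨l, hl⟩).2
  · intro l hl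
    simp only [hl, dif_pos]
    exact Finset.ne_of_mem_erase (f ⟨l, hl⟩).2

theorem exists_m' (hbc : b ≠ c) (hD1 : D1.Nonempty) (hcard : D3.card < D1.card + D2.card)
    (s : Fin n × Fin d) {l0 : Fin d} (hl0 : l0 ∈ D3) {r0 : Fin n × Fin d}
    (hr0 : r0 ∈ TT b c D1 D2) (hs : r0 ≠ s) :
    ∃ m : Fin d → Fin n × Fin d, (∀ l ∈ D3, ∀ l' ∈ D3, m l = m l' → l = l') ∧
      (∀ l ∈ D3, m l ∈ TT b c D1 D2) ∧ (∀ l ∈ D3, m l ≠ s) ∧ m l0 = r0 := by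
  obtain ⟨m, h1, h2, h3⟩ := exists_m (D2 := D2) hbc hD1 hcard s
  refine ⟨fun l => Equiv.swap (m l0) r0 (m l), ?_, ?_, ?_, by simp⟩
  · intro l hl l' hl' h
    exact h1 l hl l' hl' (by simpa using h)
  · intro l hl
    simp only [Equiv.swap_apply_def]
    split_ifs
    exacts [hr0, h2 _ hl0, h2 _ hl]
  · intro l hl
    simp only [Equiv.swap_apply_def]
    split_ifs
    exacts [hs, h3 _ hl0, h3 _ hl]

/-- Base labeling. -/
def GG (a : Fin n) (D3 : Finset (Fin d)) (m : Fin d → Fin n × Fin d) (u : Fin n × Fin d) :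
    Fin n × Fin d := if u.1 = a ∧ u.2 ∈ D3 then m u.2 else u

theorem base_mem (hab : a ≠ b) (hac : a ≠ c) (hbc : b ≠ c) {m : Fin d → Fin n × Fin d}
    (h1 : ∀ l ∈ D3, ∀ l' ∈ D3, m l = m l' → l = l') (h2 : ∀ l ∈ D3, m l ∈ TT b c D1 D2) :
    vec (GG a D3 m) ∈ face a b c D1 D2 D3 := by
  have hT : ∀ u ∈ TT b c D1 D2, u.1 ≠ a := by
    intro u hu; rcases mem_TT.1 hu with h | h <;> rw [h.1]
    exacts [hab.symm, hac.symm]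
  have hTG : ∀ u ∈ TT b c D1 D2, GG a D3 m u = u := by
    intro u hu; simp [GG, hT u hu]
  apply vec_mem_face hab hac hbc
  · intro x l t h
    have := fun l hl => hT _ (h2 l hl)
    simp only [GG] at h
    split_ifs at h with h3 h4 h4
    · exact h1 _ h3.2 _ h4.2 h
    · exact absurd (by rw [h]; exact h3.1) (this _ h3.2)
    · exact absurd (by rw [← h]; exact h4.1) (this _ h4.2)
    · simpa using h
  · intro l hl
    refine ⟨m l, h2 l hl, ?_⟩
    rw [hTG _ (h2 l hl)]; simp [GG, hl]
  · intro u hu v hv huv h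
    rw [hTG u hu, hTG v hv] at h
    exact absurd (by rw [h]) huv

theorem move_mem (hab : a ≠ b) (hac : a ≠ c) (hbc : b ≠ c) {m : Fin d → Fin n × Fin d}
    (h1 : ∀ l ∈ D3, ∀ l' ∈ D3, m l = m l' → l = l') (h2 : ∀ l ∈ D3, m l ∈ TT b c D1 D2)
    {p r : Fin n × Fin d} (hp : ¬ (p.1 = a ∧ p.2 ∈ D3)) (hpm : ∀ l ∈ D3, m l ≠ p)
    (hr : ∀ v : Fin n × Fin d, v.1 = p.1 → GG a D3 m v ≠ GG a D3 m r)
    (ht : p ∈ TT b c D1 D2 → GG a D3 m r ∈ TT b c D1 D2 → r.1 = a ∧ r.2 ∈ D3) :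
    vec (Function.update (GG a D3 m) p (GG a D3 m r)) ∈ face a b c D1 D2 D3 := by
  have hT : ∀ u ∈ TT b c D1 D2, u.1 ≠ a := by
    intro u hu; rcases mem_TT.1 hu with h | h <;> rw [h.1]
    exacts [hab.symm, hac.symm]
  have hTG : ∀ u ∈ TT b c D1 D2, GG a D3 m u = u := by
    intro u hu; simp [GG, hT u hu]
  have hlp : ∀ l ∈ D3, (a, l) ≠ p := by
    rintro l hl rfl; exact hp ⟨rfl, hl⟩
  apply vec_mem_face hab hac hbc
  · intro x l t h
    simp only [Function.update_apply] at h
    split_ifs at h with h3 h4 h4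
    · simpa using h3.trans h4.symm
    · exact absurd h.symm (hr _ (by rw [← h3]))
    · exact absurd h (hr _ (by rw [← h4]))
    · have := fun l hl => hT _ (h2 l hl)
      simp only [GG] at h
      split_ifs at h with h3 h4 h4
      · exact h1 _ h3.2 _ h4.2 h
      · exact absurd (by rw [h]; exact h3.1) (this _ h3.2)
      · exact absurd (by rw [← h]; exact h4.1) (this _ h4.2)
      · simpa using h
  · intro l hl
    refine ⟨m l, h2 l hl, ?_⟩
    rw [Function.update_of_ne (hlp l hl), Function.update_of_ne (hpm l hl), hTG _ (h2 l hl)]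
    simp [GG, hl]
  · intro u hu v hv huv h
    have hra : r.1 = a ∧ r.2 ∈ D3 →
        ∃ l ∈ D3, Function.update (GG a D3 m) p (GG a D3 m r) (a, l) = GG a D3 m r := by
      intro h
      refine ⟨r.2, h.2, ?_⟩
      rw [Function.update_of_ne (hlp _ h.2), ← h.1]
    by_cases hup : u = p
    · subst hup
      have hvu : v ≠ u := fun h => huv (by rw [h])
      rw [Function.update_self, Function.update_of_ne hvu, hTG v hv] at h
      rw [Function.update_self]
      exact hra (ht hu (h ▸ hv))
    · by_cases hvp : v = p
      · subst hvp
        rw [h]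
        rw [Function.update_self, Function.update_of_ne hup, hTG u hu] at h
        rw [Function.update_self]
        exact hra (ht hv (h ▸ hu))
      · rw [Function.update_of_ne hup, Function.update_of_ne hvp, hTG u hu, hTG v hv] at h
        exact absurd (by rw [h]) huv

theorem GG_singleton {m : Fin d → Fin n × Fin d} 
    {p : Fin n × Fin d} (hp : ¬ (p.1 = a ∧ p.2 ∈ D3)) (hpm : ∀ l ∈ D3, m l ≠ p)
    (v : Fin n × Fin d) : GG a D3 m v = GG a D3 m p ↔ v = p := by
  refine ⟨fun h => ?_, fun h => by rw [h]⟩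
  simp only [GG, if_neg hp] at h
  split_ifs at h with h3
  · exact absurd h (hpm _ h3.2)
  · exact h

theorem GG_pair {m : Fin d → Fin n × Fin d} (hm : ∀ l ∈ D3, (m l).1 ≠ a)
    (h1 : ∀ l ∈ D3, ∀ l' ∈ D3, m l = m l' → l = l')
    {l : Fin d} (hl : l ∈ D3)
    (v : Fin n × Fin d) : GG a D3 m v = GG a D3 m (a, l) ↔ v = (a, l) ∨ v = m l := by
  have : GG a D3 m (a, l) = m l := by simp [GG, hl]
  rw [this]
  constructor
  · intro h
    simp only [GG] at h
    split_ifs at h with h3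
    · left; exact Prod.ext h3.1 (h1 _ h3.2 _ hl h)
    · right; exact h
  · rintro (h | h)
    · rw [h, this]
    · rw [h]; simp [GG, hm l hl]

theorem diff_single {G : Fin n × Fin d → Fin n × Fin d} {p r : Fin n × Fin d} (hpr : p ≠ r)
    (hp : ∀ v, G v = G p ↔ v = p) (hr : ∀ v, G v = G r ↔ v = r) :
    vec (Function.update G p (G r)) - vec G = ev p r := by
  funext z
  have hz : (z.1.1.1, z.2.1) ≠ (z.1.1.2, z.2.2) := fun h =>
    (z.1.2).ne (congrArg Prod.fst h)
  simp only [Pi.sub_apply, vec, ev]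
  generalize (z.1.1.1, z.2.1) = u at *
  generalize (z.1.1.2, z.2.2) = v at *
  simp only [Function.update_apply]
  grind

theorem diff_pair {G : Fin n × Fin d → Fin n × Fin d} {p r r' : Fin n × Fin d} (hpr : p ≠ r)
    (hpr' : p ≠ r') (hrr : r ≠ r')
    (hp : ∀ v, G v = G p ↔ v = p) (hr : ∀ v, G v = G r ↔ v = r ∨ v = r') :
    vec (Function.update G p (G r)) - vec G = ev p r + ev p r' := by
  funext z
  have hz : (z.1.1.1, z.2.1) ≠ (z.1.1.2, z.2.2) := fun h =>
    (z.1.2).ne (congrArg Prod.fst h)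
  simp only [Pi.sub_apply, Pi.add_apply, vec, ev]
  generalize (z.1.1.1, z.2.1) = u at *
  generalize (z.1.1.2, z.2.2) = v at *
  simp only [Function.update_apply]
  grind

theorem single_mem (hab : a ≠ b) (hac : a ≠ c) (hbc : b ≠ c) (hD1 : D1.Nonempty)
    (hcard : D3.card < D1.card + D2.card) {p r : Fin n × Fin d} (hpr : p.1 ≠ r.1)
    (hp : ¬ (p.1 = a ∧ p.2 ∈ D3)) (hr : ¬ (r.1 = a ∧ r.2 ∈ D3))
    (hT : ¬ (p ∈ TT b c D1 D2 ∧ r ∈ TT b c D1 D2)) :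
    ev p r ∈ vectorSpan ℝ (face a b c D1 D2 D3) := by
  obtain ⟨m, h1, h2, h3⟩ := exists_m (D2 := D2) hbc hD1 hcard (if p ∈ TT b c D1 D2 then p else r)
  have hpm : ∀ l ∈ D3, m l ≠ p := by
    intro l hl h
    have := h3 l hl; have := h2 l hl
    grind
  have hrm : ∀ l ∈ D3, m l ≠ r := by
    intro l hl h
    have := h3 l hl; have := h2 l hl
    grind
  have hG := GG_singleton hr hrm
  rw [← diff_single (fun h => hpr (by rw [h])) (GG_singleton hp hpm) hG]
  refine vsub_mem_vectorSpan ℝ (move_mem hab hac hbc h1 h2 hp hpm ?_ ?_)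
    (base_mem hab hac hbc h1 h2)
  · intro v hv h
    rw [hG v] at h
    exact hpr (by rw [← hv, h])
  · intro h h'
    have : GG a D3 m r = r := by simp only [GG, if_neg hr]
    rw [this] at h'
    exact absurd ⟨h, h'⟩ hT

theorem pair_mem (hab : a ≠ b) (hac : a ≠ c) (hbc : b ≠ c) (hD1 : D1.Nonempty)
    (hcard : D3.card < D1.card + D2.card) {p r : Fin n × Fin d} (hpr : p.1 ≠ r.1)
    (hp : p.1 ≠ a) (hr : r ∈ TT b c D1 D2) {l : Fin d} (hl : l ∈ D3) :
    ev p (a, l) + ev p r ∈ vectorSpan ℝ (face a b c D1 D2 D3) := by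
  obtain ⟨m, h1, h2, h3, h4⟩ := exists_m' (D2 := D2) hbc hD1 hcard p hl hr
    (fun h => hpr (by rw [h]))
  have hT : ∀ u ∈ TT b c D1 D2, u.1 ≠ a := by
    intro u hu; rcases mem_TT.1 hu with h | h <;> rw [h.1]
    exacts [hab.symm, hac.symm]
  have hG := GG_pair (a := a) (fun l hl => hT _ (h2 l hl)) h1 hl
  have hp' : ¬ (p.1 = a ∧ p.2 ∈ D3) := fun h => hp h.1
  rw [h4] at hG
  rw [← diff_pair (fun h => hp (by rw [h])) (fun h => hpr (by rw [h]))
    (fun h => hT r hr (by rw [← h])) (GG_singleton hp' h3) hG]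
  refine vsub_mem_vectorSpan ℝ (move_mem hab hac hbc h1 h2 hp' h3 ?_ ?_)
    (base_mem hab hac hbc h1 h2)
  · intro v hv h
    rw [hG v] at h
    rcases h with h | h
    · exact hp (by rw [← hv, h])
    · exact hpr (by rw [← hv, h])
  · intro _ _; exact ⟨rfl, hl⟩

theorem all_mem (hab : a ≠ b) (hac : a ≠ c) (hbc : b ≠ c) (hD1 : D1.Nonempty)
    (hD2 : D2.Nonempty) (hcard : D3.card < D1.card + D2.card)
    {l0 t0 : Fin d} (hl0 : l0 ∈ D3) (ht0 : t0 ∈ D1)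
    (p r : Fin n × Fin d) (hpr : p.1 ≠ r.1) :
    ev p r ∈ vectorSpan ℝ (face a b c D1 D2 D3) ⊔ ℝ ∙ (ev (a, l0) (b, t0)) := by
  set V := vectorSpan ℝ (face a b c D1 D2 D3) with hV
  set W := V ⊔ ℝ ∙ (ev (a, l0) (b, t0)) with hW
  have hVW : V ≤ W := le_sup_left
  have hw : ev (a, l0) (b, t0) ∈ W := (le_sup_right : _ ≤ W) (Submodule.mem_span_singleton_self _)
  have pm : ∀ {p r : Fin n × Fin d}, p.1 ≠ r.1 → p.1 ≠ a → r ∈ TT b c D1 D2 → ∀ {l}, l ∈ D3 →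
      ev p (a, l) + ev p r ∈ W := fun h1 h2 h3 _ h4 =>
    hVW (pair_mem hab hac hbc hD1 hcard h1 h2 h3 h4)
  have bT : ∀ {t}, t ∈ D1 → (b, t) ∈ TT b c D1 D2 := fun h => mem_TT.2 (Or.inl ⟨rfl, h⟩)
  have cT : ∀ {t}, t ∈ D2 → (c, t) ∈ TT b c D1 D2 := fun h => mem_TT.2 (Or.inr ⟨rfl, h⟩)
  obtain ⟨q0, hq0⟩ := hD2
  have e1 : ∀ q ∈ D2, ev (b, t0) (c, q) ∈ W := fun q hq =>
    (Submodule.add_mem_iff_right W (by rw [ev_symm]; exact hw)).1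
      (pm (p := (b, t0)) (r := (c, q)) hbc hab.symm (cT hq) hl0)
  have e2 : ∀ l ∈ D3, ∀ q ∈ D2, ev (c, q) (a, l) ∈ W := fun l hl q hq =>
    (Submodule.add_mem_iff_left W (by rw [ev_symm]; exact e1 q hq)).1
      (pm (p := (c, q)) (r := (b, t0)) hbc.symm hac.symm (bT ht0) hl)
  have e3 : ∀ t ∈ D1, ∀ q ∈ D2, ev (c, q) (b, t) ∈ W := fun t ht q hq =>
    (Submodule.add_mem_iff_right W (e2 l0 hl0 q hq)).1
      (pm (p := (c, q)) (r := (b, t)) hbc.symm hac.symm (bT ht) hl0)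
  have e4 : ∀ l ∈ D3, ∀ t ∈ D1, ev (b, t) (a, l) ∈ W := fun l hl t ht =>
    (Submodule.add_mem_iff_left W (by rw [ev_symm]; exact e3 t ht q0 hq0)).1
      (pm (p := (b, t)) (r := (c, q0)) hbc hab.symm (cT hq0) hl)
  have hT : ∀ u ∈ TT b c D1 D2, u.1 ≠ a := by
    intro u hu; rcases mem_TT.1 hu with h | h <;> rw [h.1]
    exacts [hab.symm, hac.symm]
  -- partner of a centre element of D3
  have e5 : ∀ l ∈ D3, ∀ p : Fin n × Fin d, p.1 ≠ a → ev p (a, l) ∈ W := by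
    intro l hl p hp
    by_cases hpT : p ∈ TT b c D1 D2
    · obtain ⟨p1, p2⟩ := p
      rcases mem_TT.1 hpT with ⟨h, h'⟩ | ⟨h, h'⟩
      · simp only at h h'; subst h; exact e4 l hl p2 h'
      · simp only at h h'; subst h; exact e2 l hl p2 h'
    · obtain ⟨r, hr, hpr⟩ : ∃ r ∈ TT b c D1 D2, p.1 ≠ r.1 := by
        by_cases h : p.1 = b
        · exact ⟨(c, q0), cT hq0, by rw [h]; exact hbc⟩
        · exact ⟨(b, t0), bT ht0, h⟩
      refine (Submodule.add_mem_iff_left W ?_).1 (pm hpr hp hr hl)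
      exact hVW (single_mem hab hac hbc hD1 hcard hpr (fun h => hp h.1)
        (fun h => hT r hr h.1) (fun h => hpT h.1))
  by_cases hp : p.1 = a ∧ p.2 ∈ D3
  · obtain ⟨p1, p2⟩ := p
    obtain ⟨h, h'⟩ := hp
    simp only at h h' hpr; subst h
    rw [ev_symm]; exact e5 p2 h' r hpr.symm
  by_cases hr : r.1 = a ∧ r.2 ∈ D3
  · obtain ⟨r1, r2⟩ := r
    obtain ⟨h, h'⟩ := hr
    simp only at h h' hpr; subst h
    exact e5 r2 h' p hpr
  by_cases hTT : p ∈ TT b c D1 D2 ∧ r ∈ TT b c D1 D2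
  · obtain ⟨p1, p2⟩ := p
    obtain ⟨r1, r2⟩ := r
    simp only [mem_TT] at hTT hpr
    rcases hTT with ⟨⟨h1, h2⟩ | ⟨h1, h2⟩, ⟨h3, h4⟩ | ⟨h3, h4⟩⟩
    · exact absurd (h1.trans h3.symm) hpr
    · rw [h1, h3, ev_symm]; exact e3 _ h2 _ h4
    · rw [h1, h3]; exact e3 _ h4 _ h2
    · exact absurd (h1.trans h3.symm) hpr
  · exact hVW (single_mem hab hac hbc hD1 hcard hpr hp hr hTT)

theorem sup_top (hab : a ≠ b) (hac : a ≠ c) (hbc : b ≠ c) (hD1 : D1.Nonempty)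
    (hD2 : D2.Nonempty) (hcard : D3.card < D1.card + D2.card)
    {l0 t0 : Fin d} (hl0 : l0 ∈ D3) (ht0 : t0 ∈ D1) :
    vectorSpan ℝ (face a b c D1 D2 D3) ⊔ ℝ ∙ (ev (a, l0) (b, t0)) = ⊤ := by
  rw [eq_top_iff, ← (Pi.basisFun ℝ (JIdx n d)).span_eq, Submodule.span_le]
  rintro _ ⟨z, rfl⟩
  have : Pi.basisFun ℝ (JIdx n d) z = ev (z.1.1.1, z.2.1) (z.1.1.2, z.2.2) := by
    funext w
    rw [Pi.basisFun_apply, Pi.single_apply, ev]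
    congr 1
    obtain ⟨⟨⟨w1, w2⟩, hw⟩, w3, w4⟩ := w
    obtain ⟨⟨⟨z1, z2⟩, hz⟩, z3, z4⟩ := z
    simp only [Prod.mk.injEq, Subtype.mk.injEq, eq_iff_iff] at *
    constructor
    · rintro ⟨⟨h1, h2⟩, h3, h4⟩; exact Or.inl ⟨⟨h1, h3⟩, h2, h4⟩
    · rintro (⟨⟨h1, h3⟩, h2, h4⟩ | ⟨⟨h1, h3⟩, h2, h4⟩)
      · exact ⟨⟨h1, h2⟩, h3, h4⟩
      · subst h1 h2; exact absurd hw hz.not_gt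
  rw [this]
  exact all_mem hab hac hbc hD1 hD2 hcard hl0 ht0 _ _ z.1.2.ne

theorem card_pair (n : ℕ) : Fintype.card (PairIdx n) = n.choose 2 := by
  rw [Fintype.card_subtype]
  have : (Finset.univ.filter fun p : Fin n × Fin n => p.1 < p.2).card
      = ∑ j : Fin n, (Finset.univ.filter fun i : Fin n => i < j).card := by
    simp only [Finset.card_filter]
    rw [Fintype.sum_prod_type_right]
  rw [this]
  have h : ∀ j : Fin n, (Finset.univ.filter fun i : Fin n => i < j).card = j := by
    intro j
    rw [Finset.filter_gt_eq_Iio, Fin.card_Iio]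
  rw [Finset.sum_congr rfl fun j _ => h j]
  rw [Fin.sum_univ_eq_sum_range (fun i => i), Finset.sum_range_id, Nat.choose_two_right]

theorem facet (hab : a ≠ b) (hac : a ≠ c) (hbc : b ≠ c) (hD1 : D1.Nonempty)
    (hD2 : D2.Nonempty) (hD3 : D3.Nonempty) (hcard : D3.card < D1.card + D2.card) :
    Module.finrank ℝ (vectorSpan ℝ (face a b c D1 D2 D3)) = n.choose 2 * d ^ 2 - 1 := by
  obtain ⟨l0, hl0⟩ := id hD3
  obtain ⟨t0, ht0⟩ := id hD1
  have htop := sup_top hab hac hbc hD1 hD2 hcard hl0 ht0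
  have hN : Module.finrank ℝ (JIdx n d → ℝ) = n.choose 2 * d ^ 2 := by
    rw [Module.finrank_fintype_fun_eq_card, Fintype.card_prod, card_pair]
    simp [sq]
  have hge : n.choose 2 * d ^ 2 ≤ Module.finrank ℝ (vectorSpan ℝ (face a b c D1 D2 D3)) + 1 := by
    have h := Submodule.finrank_add_le_finrank_add_finrank
      (vectorSpan ℝ (face a b c D1 D2 D3)) (ℝ ∙ (ev (a, l0) (b, t0)))
    rw [htop, finrank_top, hN] at h
    have : Module.finrank ℝ (ℝ ∙ (ev (a, l0) (b, t0))) ≤ 1 := by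
      simpa using finrank_span_le_card (R := ℝ) ({ev (a, l0) (b, t0)} : Set (JIdx n d → ℝ))
    omega
  have hle : vectorSpan ℝ (face a b c D1 D2 D3) ≤ LinearMap.ker (blk a b c D1 D2 D3) := by
    rw [vectorSpan_def, Submodule.span_le]
    rintro _ ⟨x, hx, y, hy, rfl⟩
    simp [hx.2, hy.2]
  have hlt : Module.finrank ℝ (vectorSpan ℝ (face a b c D1 D2 D3)) < n.choose 2 * d ^ 2 := by
    rw [← hN]
    apply Submodule.finrank_lt
    intro h
    rw [h, top_le_iff, LinearMap.ker_eq_top] at hle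
    obtain ⟨m, h1, h2, -⟩ := exists_m (D2 := D2) hbc hD1 hcard (a, l0)
    have := (base_mem hab hac hbc h1 h2).2
    rw [hle] at this
    have h0 : (D3.card : ℝ) = 0 := by rw [← this]; rfl
    exact hD3.card_pos.ne' (by exact_mod_cast h0)
  omega

theorem fam (hab : a ≠ b) (hac : a ≠ c) (hbc : b ≠ c) (hD1 : D1.Nonempty)
    (hD2 : D2.Nonempty) (hD3 : D3.Nonempty) (hcard : D3.card < D1.card + D2.card)
    (f : (JIdx n d → ℝ) → ℝ) (hf : ∀ x, blk a b c D1 D2 D3 x = f x) :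
    (∀ x ∈ jointMatchingPolytope n d, f x ≤ (D3.card : ℝ)) ∧
      Module.finrank ℝ (vectorSpan ℝ {x ∈ jointMatchingPolytope n d | f x = (D3.card : ℝ)}) =
        n.choose 2 * d ^ 2 - 1 := by
  obtain rfl : (fun x => blk a b c D1 D2 D3 x) = f := funext hf
  exact ⟨fun x hx => blk_valid hab hac hbc D1 D2 D3 hx, facet hab hac hbc hD1 hD2 hD3 hcard⟩

end moves

end JMP

open JMP

/-- Every block consistency inequality with `|D1| + |D2| > |D3|` is facet-defining for
the joint matching polytope: each of the three families is valid, and the corresponding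
face has affine dimension `(n choose 2) * d ^ 2 - 1`. -/
theorem block_consistency_inequalities_facet_defining (n d : ℕ) (hn : 3 ≤ n) (hd : 2 ≤ d)
    (D1 D2 D3 : Finset (Fin d)) (hD1 : D1.Nonempty) (hD2 : D2.Nonempty) (hD3 : D3.Nonempty)
    (hcard : D3.card < D1.card + D2.card)
    (i j k : Fin n) (hij : i < j) (hjk : j < k) :
    ((∀ x ∈ jointMatchingPolytope n d,
        -∑ t ∈ D1, ∑ q ∈ D2, x (⟨(i, j), hij⟩, (t, q))
          + ∑ q ∈ D2, ∑ l ∈ D3, x (⟨(j, k), hjk⟩, (q, l))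
          + ∑ t ∈ D1, ∑ l ∈ D3, x (⟨(i, k), lt_trans hij hjk⟩, (t, l)) ≤ (D3.card : ℝ)) ∧
      Module.finrank ℝ
          ↥(vectorSpan ℝ {x ∈ jointMatchingPolytope n d |
              -∑ t ∈ D1, ∑ q ∈ D2, x (⟨(i, j), hij⟩, (t, q))
                + ∑ q ∈ D2, ∑ l ∈ D3, x (⟨(j, k), hjk⟩, (q, l))
                + ∑ t ∈ D1, ∑ l ∈ D3, x (⟨(i, k), lt_trans hij hjk⟩, (t, l))
                = (D3.card : ℝ)}) =
        n.choose 2 * d ^ 2 - 1) ∧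
    ((∀ x ∈ jointMatchingPolytope n d,
        ∑ l ∈ D3, ∑ t ∈ D1, x (⟨(i, j), hij⟩, (l, t))
          - ∑ t ∈ D1, ∑ q ∈ D2, x (⟨(j, k), hjk⟩, (t, q))
          + ∑ l ∈ D3, ∑ q ∈ D2, x (⟨(i, k), lt_trans hij hjk⟩, (l, q)) ≤ (D3.card : ℝ)) ∧
      Module.finrank ℝ
          ↥(vectorSpan ℝ {x ∈ jointMatchingPolytope n d |
              ∑ l ∈ D3, ∑ t ∈ D1, x (⟨(i, j), hij⟩, (l, t))
                - ∑ t ∈ D1, ∑ q ∈ D2, x (⟨(j, k), hjk⟩, (t, q))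
                + ∑ l ∈ D3, ∑ q ∈ D2, x (⟨(i, k), lt_trans hij hjk⟩, (l, q))
                = (D3.card : ℝ)}) =
        n.choose 2 * d ^ 2 - 1) ∧
    ((∀ x ∈ jointMatchingPolytope n d,
        ∑ t ∈ D1, ∑ l ∈ D3, x (⟨(i, j), hij⟩, (t, l))
          + ∑ l ∈ D3, ∑ q ∈ D2, x (⟨(j, k), hjk⟩, (l, q))
          - ∑ t ∈ D1, ∑ q ∈ D2, x (⟨(i, k), lt_trans hij hjk⟩, (t, q)) ≤ (D3.card : ℝ)) ∧
      Module.finrank ℝ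
          ↥(vectorSpan ℝ {x ∈ jointMatchingPolytope n d |
              ∑ t ∈ D1, ∑ l ∈ D3, x (⟨(i, j), hij⟩, (t, l))
                + ∑ l ∈ D3, ∑ q ∈ D2, x (⟨(j, k), hjk⟩, (l, q))
                - ∑ t ∈ D1, ∑ q ∈ D2, x (⟨(i, k), lt_trans hij hjk⟩, (t, q))
                = (D3.card : ℝ)}) =
        n.choose 2 * d ^ 2 - 1) := by
  have hik := lt_trans hij hjk
  have A : ∀ x, blk k i j D1 D2 D3 x =
      -∑ t ∈ D1, ∑ q ∈ D2, x (⟨(i, j), hij⟩, (t, q))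
          + ∑ q ∈ D2, ∑ l ∈ D3, x (⟨(j, k), hjk⟩, (q, l))
          + ∑ t ∈ D1, ∑ l ∈ D3, x (⟨(i, k), lt_trans hij hjk⟩, (t, l)) := by
    intro x
    rw [blk_apply]
    simp only [yL_lt (p := (i, _)) (r := (j, _)) hij, yL_gt (p := (k, _)) (r := (j, _)) hjk,
      yL_gt (p := (k, _)) (r := (i, _)) hik]
    rw [Finset.sum_comm (s := D3) (t := D1), Finset.sum_comm (s := D3) (t := D2)]
    ring
  have B : ∀ x, blk i j k D1 D2 D3 x =
      ∑ l ∈ D3, ∑ t ∈ D1, x (⟨(i, j), hij⟩, (l, t))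
          - ∑ t ∈ D1, ∑ q ∈ D2, x (⟨(j, k), hjk⟩, (t, q))
          + ∑ l ∈ D3, ∑ q ∈ D2, x (⟨(i, k), lt_trans hij hjk⟩, (l, q)) := by
    intro x
    rw [blk_apply]
    simp only [yL_lt (p := (i, _)) (r := (j, _)) hij, yL_lt (p := (j, _)) (r := (k, _)) hjk,
      yL_lt (p := (i, _)) (r := (k, _)) hik]
    ring
  have C : ∀ x, blk j i k D1 D2 D3 x =
      ∑ t ∈ D1, ∑ l ∈ D3, x (⟨(i, j), hij⟩, (t, l))
          + ∑ l ∈ D3, ∑ q ∈ D2, x (⟨(j, k), hjk⟩, (l, q))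
          - ∑ t ∈ D1, ∑ q ∈ D2, x (⟨(i, k), lt_trans hij hjk⟩, (t, q)) := by
    intro x
    rw [blk_apply]
    simp only [yL_gt (p := (j, _)) (r := (i, _)) hij, yL_lt (p := (j, _)) (r := (k, _)) hjk,
      yL_lt (p := (i, _)) (r := (k, _)) hik]
    rw [Finset.sum_comm (s := D3) (t := D1)]
  exact ⟨fam hik.ne' hjk.ne' hij.ne hD1 hD2 hD3 hcard _ A,
    fam hij.ne hik.ne hjk.ne hD1 hD2 hD3 hcard _ B,
    fam hij.ne' hjk.ne hik.ne hD1 hD2 hD3 hcard _ C⟩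
end

section
/- Let X(i,j) ∈ {0,1}^{d_i×d_j}, 1 ≤ i < j ≤ n, be a collection of consistent partial maps that admits a universe of size at most m̂, i.e., there is a map σ from the set N of all elements of all objects to a set of size m̂ such that σ is injective on the elements of each single object and, for all 1 ≤ i < j ≤ n, t ∈ [d_i], q ∈ [d_j], X_{tq}(i,j) = 1 if and only if σ(i_t) = σ(j_q). Then for every subset N' ⊆ N of cardinality m̂ + 1, the size inequality Σ_{1≤i<j≤n} Σ_{t∈[d_i], q∈[d_j] : i_t ∈ N', j_q ∈ N'} X_{tq}(i,j) ≥ 1 holds. -/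
/-- Validity of the size inequalities: if a collection of consistent partial maps admits
a universe of size at most `mhat`, then for every set `N'` of `mhat + 1` elements, the sum of
the matched pairs with both endpoints in `N'` is at least one. -/
theorem size_inequalities_valid
    (n : ℕ) (hn : 3 ≤ n) (d : Fin n → ℕ) (hd : ∀ i, 1 ≤ d i) (hdmax : ∃ i, 2 ≤ d i)
    (X : ∀ i j : Fin n, Matrix (Fin (d i)) (Fin (d j)) ℝ)
    (hbin : ∀ i j : Fin n, i < j → ∀ t q, X i j t q = 0 ∨ X i j t q = 1)
    (hrow : ∀ i j : Fin n, i < j → ∀ t, ∑ q, X i j t q ≤ 1)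
    (hcol : ∀ i j : Fin n, i < j → ∀ q, ∑ t, X i j t q ≤ 1)
    (hgtri : ∀ i j k : Fin n, i < j → j < k →
        ∀ (l : Fin (d i)) (t : Fin (d j)) (q : Fin (d k)),
          - X i j l t + X j k t q + X i k l q ≤ 1 ∧
          X i j l t - X j k t q + X i k l q ≤ 1 ∧
          X i j l t + X j k t q - X i k l q ≤ 1)
    (mhat : ℕ) (σ : ((i : Fin n) × Fin (d i)) → Fin mhat)
    (hinj : ∀ i : Fin n, Function.Injective fun t : Fin (d i) => σ ⟨i, t⟩)
    (hσ : ∀ i j : Fin n, i < j → ∀ (t : Fin (d i)) (q : Fin (d j)),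
        X i j t q = 1 ↔ σ ⟨i, t⟩ = σ ⟨j, q⟩)
    (N' : Finset ((i : Fin n) × Fin (d i))) (hN' : N'.card = mhat + 1) :
    1 ≤ ∑ i : Fin n, ∑ j : Fin n,
          if i < j then
            ∑ t : Fin (d i), ∑ q : Fin (d j),
              if (⟨i, t⟩ : (i : Fin n) × Fin (d i)) ∈ N' ∧
                  (⟨j, q⟩ : (i : Fin n) × Fin (d i)) ∈ N' then X i j t q else 0
          else 0 := by
  have hpair : ∃ i j : Fin n, i < j ∧ ∃ (t : Fin (d i)) (q : Fin (d j)),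
      (⟨i, t⟩ : (i : Fin n) × Fin (d i)) ∈ N' ∧
      (⟨j, q⟩ : (i : Fin n) × Fin (d i)) ∈ N' ∧ X i j t q = 1 := by
    obtain ⟨⟨i, t⟩, hx, ⟨j, q⟩, hy, hne, heq⟩ :=
      Finset.exists_ne_map_eq_of_card_lt_of_maps_to (s := N') (t := Finset.univ) (f := σ)
        (by simp [hN']) (by intro x _; simp)
    rcases lt_trichotomy i j with h | h | h
    · exact ⟨i, j, h, t, q, hx, hy, (hσ i j h t q).2 heq⟩
    · subst h
      have h2 : t = q := hinj i heq
      exact absurd (by rw [h2]) hne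
    · exact ⟨j, i, h, q, t, hy, hx, (hσ j i h q t).2 heq.symm⟩
  obtain ⟨i, j, hij, t, q, hx, hy, hX⟩ := hpair
  have h4 : ∀ i j : Fin n, i < j → ∀ t q, 0 ≤ (if (⟨i, t⟩ : (i : Fin n) × Fin (d i)) ∈ N' ∧
      (⟨j, q⟩ : (i : Fin n) × Fin (d i)) ∈ N' then X i j t q else 0) := by
    intro i j h t q
    split_ifs
    · rcases hbin i j h t q with h | h <;> rw [h]
      exact zero_le_one
    · exact le_rfl
  have h2 : ∀ i j : Fin n, 0 ≤ (if i < j then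
            ∑ t : Fin (d i), ∑ q : Fin (d j),
              if (⟨i, t⟩ : (i : Fin n) × Fin (d i)) ∈ N' ∧
                  (⟨j, q⟩ : (i : Fin n) × Fin (d i)) ∈ N' then X i j t q else 0
          else 0) := by
    intro i j
    by_cases h : i < j
    · rw [if_pos h]
      exact Finset.sum_nonneg fun t _ => Finset.sum_nonneg fun q _ => h4 i j h t q
    · rw [if_neg h]
  refine le_trans ?_ (Finset.single_le_sum
    (fun i _ => Finset.sum_nonneg fun j _ => h2 i j) (Finset.mem_univ i))
  refine le_trans ?_ (Finset.single_le_sum (fun j _ => h2 i j) (Finset.mem_univ j))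
  rw [if_pos hij]
  refine le_trans ?_ (Finset.single_le_sum
    (fun t _ => Finset.sum_nonneg fun q _ => h4 i j hij t q) (Finset.mem_univ t))
  refine le_trans ?_ (Finset.single_le_sum (fun q _ => h4 i j hij t q) (Finset.mem_univ q))
  rw [if_pos ⟨hx, hy⟩, hX]
end

section
/- Let α > 0 and β > 0. Suppose each input map X^in(i,j), 1 ≤ i < j ≤ n, is a d×d permutation matrix, and define a, δ and κ as in the context. Then the ground truth X̄ (with X̄(i,j) = I_d for all i < j) is an optimal solution of the basic LP (P) provided that for each t,q ∈ [d] and each 1 ≤ i < j ≤ n the following hold: (C1) if a_tt(i,j) = a_qq(i,j) = a_tq(i,j) = 1 then δ_{t→q}^{i→j} ≥ 0 and δ_{q→t}^{j→i} ≥ 0; (C2) if a_tt(i,j) = a_qq(i,j) = 1 and a_tq(i,j) = −1 then δ_{t→q}^{i→j} ≥ 1 and δ_{q→t}^{j→i} ≥ 1; (C3) if a_tt(i,j) = a_qq(i,j) = −1 and a_tq(i,j) = 1 then κ_t(i,j) + (δ_{t→q}^{i→j} + δ_{q→t}^{j→i})/2 ≥ 0 and κ_q(i,j) + (δ_{t→q}^{i→j}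 + δ_{q→t}^{j→i})/2 ≥ 0; (C4) if a_tt(i,j) = 1, a_qq(i,j) = −1, a_tq(i,j) = 1 then κ_q(i,j) + δ_{t→q}^{i→j} + δ_{q→t}^{j→i} ≥ 0; (C5) if a_tt(i,j) = −1, a_qq(i,j) = 1, a_tq(i,j) = 1 then κ_t(i,j) + δ_{t→q}^{i→j} + δ_{q→t}^{j→i} ≥ 0. -/
open Matrix
open scoped Classical

noncomputable section

/-- The permutation matrix of a permutation `σ` of `Fin d`. -/
def permMat (d : ℕ) (σ : Equiv.Perm (Fin d)) : Matrix (Fin d) (Fin d) ℝ :=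
  Matrix.of fun t q => if σ q = t then 1 else 0

/-- The objective function of the basic LP (P):
`∑_{i<j} ∑_{t,q} a_{tq}(i,j) X_{tq}(i,j)`. -/
def lpObj (n d : ℕ) (a X : Fin n → Fin n → Matrix (Fin d) (Fin d) ℝ) : ℝ :=
  ∑ p ∈ Finset.univ.filter (fun p : Fin n × Fin n => p.1 < p.2),
    ∑ t : Fin d, ∑ q : Fin d, a p.1 p.2 t q * X p.1 p.2 t q

/-- The feasible region of the basic LP (P): all row and column sums equal one,
the triangle inequalities hold, and all entries are nonnegative. -/
def lpFeasible (n d : ℕ) (X : Fin n → Fin n → Matrix (Fin d) (Fin d) ℝ) : Prop :=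
  (∀ i j : Fin n, i < j → ∀ t : Fin d, ∑ q : Fin d, X i j t q = 1) ∧
  (∀ i j : Fin n, i < j → ∀ q : Fin d, ∑ t : Fin d, X i j t q = 1) ∧
  (∀ i j k : Fin n, i < j → j < k → ∀ l t q : Fin d,
      X i j l t + X j k t q - X i k l q ≤ 1 ∧
      X i j l t - X j k t q + X i k l q ≤ 1 ∧
      - X i j l t + X j k t q + X i k l q ≤ 1) ∧
  (∀ i j : Fin n, i < j → ∀ t q : Fin d, 0 ≤ X i j t q)

/-- The quantity `δ_{t→q}^{i→j}` of the dual certificate. -/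
def deltaJOM (n d : ℕ) (a : Fin n → Fin n → Matrix (Fin d) (Fin d) ℝ) (α β : ℝ)
    (i j : Fin n) (t q : Fin d) : ℝ :=
  (1 / (n : ℝ)) *
    ∑ k ∈ Finset.univ.filter (fun k : Fin n => k ≠ i ∧ k ≠ j ∧ a k i t t = -1),
      ((a k j t q - a i j t q) / α + (a i j t t - a k j t t) / (β * d))

/-- The quantity `κ_t(i,j)` of the dual certificate. -/
def kappaJOM (n d : ℕ) (a : Fin n → Fin n → Matrix (Fin d) (Fin d) ℝ) (α β : ℝ)
    (i j : Fin n) (t : Fin d) : ℝ :=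
  (1 / (n : ℝ)) *
      ∑ l ∈ Finset.univ.filter (fun l : Fin d => l ≠ t),
        ∑ k ∈ Finset.univ.filter (fun k : Fin n => k ≠ i ∧ k ≠ j),
          min (a k i l t / α + a k j t t / (β * d)) (a k j l t / α + a k i t t / (β * d))
    + (1 / (n : ℝ)) * (1 / (2 * α) - ((d : ℝ) - 1) / (2 * β * d)) *
        ((∑ k ∈ Finset.univ.filter (fun k : Fin n => k ≠ i), a k i t t) +
          ∑ k ∈ Finset.univ.filter (fun k : Fin n => k ≠ j), a k j t t)
    - ((d : ℝ) - 2) / α + 1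
    + (1 / (2 * (n : ℝ))) *
        ∑ l ∈ Finset.univ.filter (fun l : Fin d => l ≠ t),
          ((a i j t l + a j i t l) / α + 2 * a i j t t / (β * d))


/-- The (signed) multiplier of the triangle inequality. -/
def vmul (n d : ℕ) (a : Fin n → Fin n → Matrix (Fin d) (Fin d) ℝ) (α β : ℝ)
    (k i j : Fin n) (t q : Fin d) : ℝ :=
  if k ≠ i ∧ k ≠ j ∧ i ≠ j ∧ q ≠ t ∧ a k i t t = -1 then
    ((a k j t q - a i j t q) / α + (a i j t t - a k j t t) / (β * d)) else 0

/-- Total weight charged to a diagonal entry. -/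
def wmul (n d : ℕ) (a : Fin n → Fin n → Matrix (Fin d) (Fin d) ℝ) (α β : ℝ)
    (k i : Fin n) (t : Fin d) : ℝ :=
  ∑ j : Fin n, ∑ q : Fin d, |vmul n d a α β k i j t q|

lemma min_half (x y : ℝ) : min x y = (x + y) / 2 - |x - y| / 2 := by
  rcases le_total x y with h | h
  · rw [min_eq_left h, abs_of_nonpos (by linarith)]; ring
  · rw [min_eq_right h, abs_of_nonneg (by linarith)]; ring

lemma vmul_anti (n d : ℕ) (a : Fin n → Fin n → Matrix (Fin d) (Fin d) ℝ) (α β : ℝ)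
    (hs : ∀ i j t q, a j i t q = a i j q t)
    (k i j : Fin n) (t q : Fin d) : vmul n d a α β i k j t q = - vmul n d a α β k i j t q := by
  unfold vmul
  rw [hs k i t t]
  by_cases h : k ≠ i ∧ k ≠ j ∧ i ≠ j ∧ q ≠ t ∧ a k i t t = -1
  · rw [if_pos h, if_pos ⟨h.1.symm, h.2.2.1, h.2.1, h.2.2.2.1, h.2.2.2.2⟩]; ring
  · rw [if_neg h, if_neg (fun h' => h ⟨h'.1.symm, h'.2.2.1, h'.2.1, h'.2.2.2.1, h'.2.2.2.2⟩)]
    simp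

lemma wmul_symm (n d : ℕ) (a : Fin n → Fin n → Matrix (Fin d) (Fin d) ℝ) (α β : ℝ)
    (hs : ∀ i j t q, a j i t q = a i j q t)
    (k i : Fin n) (t : Fin d) : wmul n d a α β i k t = wmul n d a α β k i t := by
  unfold wmul
  refine Finset.sum_congr rfl fun j _ => Finset.sum_congr rfl fun q _ => ?_
  rw [vmul_anti n d a α β hs, abs_neg]

lemma wmul_zero (n d : ℕ) (a : Fin n → Fin n → Matrix (Fin d) (Fin d) ℝ) (α β : ℝ)
    (k i : Fin n) (t : Fin d) (h : a k i t t ≠ -1) : wmul n d a α β k i t = 0 := by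
  unfold wmul vmul
  simp [h]

lemma delta_eq (n d : ℕ) (a : Fin n → Fin n → Matrix (Fin d) (Fin d) ℝ) (α β : ℝ)
    (i j : Fin n) (t q : Fin d) (hij : i ≠ j) (htq : q ≠ t) :
    deltaJOM n d a α β i j t q = (1 / (n : ℝ)) * ∑ k, vmul n d a α β k i j t q := by
  unfold deltaJOM vmul
  rw [Finset.sum_filter]
  simp [hij, htq]

lemma vsum_zero (n d : ℕ) (a : Fin n → Fin n → Matrix (Fin d) (Fin d) ℝ) (α β : ℝ)
    (i j : Fin n) (t q : Fin d) (h : i = j ∨ q = t) :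
    ∑ k, vmul n d a α β k i j t q = 0 := by
  unfold vmul
  refine Finset.sum_eq_zero fun k _ => if_neg ?_
  rcases h with h | h <;> simp [h]

lemma star_ineq (n d : ℕ) (a : Fin n → Fin n → Matrix (Fin d) (Fin d) ℝ) (α β : ℝ)
    (hs : ∀ i j t q, a j i t q = a i j q t)
    (Y : Fin n → Fin n → Matrix (Fin d) (Fin d) ℝ)
    (hY : ∀ k i j, k ≠ i → k ≠ j → i ≠ j → ∀ t q,
      |Y i j t q - Y k j t q| ≤ 1 - Y k i t t) :
    2 * ∑ i, ∑ j, ∑ t, ∑ q, (∑ k, vmul n d a α β k i j t q) * Y i j t q ≤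
      ∑ k, ∑ i, ∑ t, wmul n d a α β k i t * (1 - Y k i t t) := by
  have h1 : ∑ k, ∑ i, ∑ j, ∑ t, ∑ q, vmul n d a α β k i j t q * (Y i j t q - Y k j t q) ≤
      ∑ k, ∑ i, ∑ j, ∑ t, ∑ q, |vmul n d a α β k i j t q| * (1 - Y k i t t) := by
    refine Finset.sum_le_sum fun k _ => Finset.sum_le_sum fun i _ => Finset.sum_le_sum fun j _ =>
      Finset.sum_le_sum fun t _ => Finset.sum_le_sum fun q _ => ?_
    by_cases h : k ≠ i ∧ k ≠ j ∧ i ≠ j ∧ q ≠ t ∧ a k i t t = -1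
    · calc _ ≤ |vmul n d a α β k i j t q * (Y i j t q - Y k j t q)| := le_abs_self _
        _ = |vmul n d a α β k i j t q| * |Y i j t q - Y k j t q| := abs_mul _ _
        _ ≤ _ := mul_le_mul_of_nonneg_left (hY k i j h.1 h.2.1 h.2.2.1 t q) (abs_nonneg _)
    · have : vmul n d a α β k i j t q = 0 := if_neg h
      simp [this]
  have h2 : ∑ k, ∑ i, ∑ j, ∑ t, ∑ q, |vmul n d a α β k i j t q| * (1 - Y k i t t) =
      ∑ k, ∑ i, ∑ t, wmul n d a α β k i t * (1 - Y k i t t) := by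
    refine Finset.sum_congr rfl fun k _ => Finset.sum_congr rfl fun i _ => ?_
    rw [Finset.sum_comm]
    refine Finset.sum_congr rfl fun t _ => ?_
    unfold wmul
    simp only [Finset.sum_mul]
  have h3 : ∑ k, ∑ i, ∑ j, ∑ t, ∑ q, vmul n d a α β k i j t q * Y i j t q =
      ∑ i, ∑ j, ∑ t, ∑ q, (∑ k, vmul n d a α β k i j t q) * Y i j t q := by
    rw [Finset.sum_comm]
    refine Finset.sum_congr rfl fun i _ => ?_
    rw [Finset.sum_comm]
    refine Finset.sum_congr rfl fun j _ => ?_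
    rw [Finset.sum_comm]
    refine Finset.sum_congr rfl fun t _ => ?_
    rw [Finset.sum_comm]
    refine Finset.sum_congr rfl fun q _ => ?_
    rw [Finset.sum_mul]
  have h4 : ∑ k, ∑ i, ∑ j, ∑ t, ∑ q, vmul n d a α β k i j t q * Y k j t q =
      - ∑ k, ∑ i, ∑ j, ∑ t, ∑ q, vmul n d a α β k i j t q * Y i j t q := by
    rw [Finset.sum_comm]
    simp only [← Finset.sum_neg_distrib]
    refine Finset.sum_congr rfl fun k _ => Finset.sum_congr rfl fun i _ =>
      Finset.sum_congr rfl fun j _ => Finset.sum_congr rfl fun t _ =>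
      Finset.sum_congr rfl fun q _ => ?_
    rw [vmul_anti n d a α β hs]; ring
  simp only [mul_sub, Finset.sum_sub_distrib] at h1 
  simp only [mul_sub, Finset.sum_sub_distrib] at h2 ⊢
  linarith

lemma kappa_le (n d : ℕ) (hn : 3 ≤ n) (hd : 2 ≤ d)
    (a : Fin n → Fin n → Matrix (Fin d) (Fin d) ℝ) (α β : ℝ) (hα : 0 < α) (hβ : 0 < β)
    (hs : ∀ i j t q, a j i t q = a i j q t)
    (hrow : ∀ i j, i ≠ j → ∀ t, ∑ q, a i j t q = (d : ℝ) - 2)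
    (i j : Fin n) (hij : i ≠ j) (t : Fin d) (ht : a i j t t = -1) :
    kappaJOM n d a α β i j t ≤ 1 - wmul n d a α β i j t / (2 * n) := by
  have hn0 : (0 : ℝ) < n := by exact_mod_cast (by omega : 0 < n)
  have hd0 : (0 : ℝ) < d := by exact_mod_cast (by omega : 0 < d)
  have hd2 : (2 : ℝ) ≤ d := by exact_mod_cast hd
  have hfl : (Finset.univ.filter fun l : Fin d => l ≠ t) = Finset.univ.erase t := by
    ext l; simp
  have hfi : ∀ i : Fin n, (Finset.univ.filter fun l : Fin n => l ≠ i) = Finset.univ.erase i := by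
    intro i; ext l; simp
  set S : Finset (Fin n) := Finset.univ.filter (fun k : Fin n => k ≠ i ∧ k ≠ j) with hS
  have hSi : (Finset.univ.erase i : Finset (Fin n)) = insert j S := by
    ext k; simp only [hS, Finset.mem_erase, Finset.mem_insert, Finset.mem_filter,
      Finset.mem_univ, true_and, and_true]
    by_cases h : k = j
    · subst h; simp [hij.symm]
    · simp [h]
  have hSj : (Finset.univ.erase j : Finset (Fin n)) = insert i S := by
    ext k; simp only [hS, Finset.mem_erase, Finset.mem_insert, Finset.mem_filter,
      Finset.mem_univ, true_and, and_true]
    by_cases h : k = i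
    · subst h; simp [hij]
    · simp [h]
  have hjS : j ∉ S := by simp [hS]
  have hiS : i ∉ S := by simp [hS]
  have hcard : (S.card : ℝ) = n - 2 := by
    have h1 := Finset.card_insert_of_notMem hjS
    rw [← hSi, Finset.card_erase_of_mem (Finset.mem_univ _), Finset.card_univ,
      Fintype.card_fin] at h1
    have : S.card + 2 = n := by omega
    have h2 : (S.card : ℝ) + 2 = n := by exact_mod_cast this
    linarith
  have hdc : ((Finset.univ.erase t : Finset (Fin d)).card : ℝ) = d - 1 := by
    rw [Finset.card_erase_of_mem (Finset.mem_univ _), Finset.card_univ, Fintype.card_fin,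
      Nat.cast_sub (by omega)]; simp
  have hr : ∀ i j, i ≠ j → ∑ l ∈ Finset.univ.erase t, a i j t l = (d : ℝ) - 2 - a i j t t := by
    intro i j h
    rw [← hrow i j h t, ← Finset.add_sum_erase _ _ (Finset.mem_univ t)]; ring
  have hw : wmul n d a α β i j t = ∑ k ∈ S, ∑ l ∈ Finset.univ.erase t,
      |(a k i l t / α + a k j t t / (β * d)) - (a k j l t / α + a k i t t / (β * d))| := by
    unfold wmul
    rw [hS, Finset.sum_filter]
    refine Finset.sum_congr rfl fun k _ => ?_
    rw [← hfl]
    by_cases hk : k ≠ i ∧ k ≠ j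
    · rw [if_pos hk, Finset.sum_filter]
      refine Finset.sum_congr rfl fun l _ => ?_
      unfold vmul
      by_cases hl : l ≠ t
      · rw [if_pos hl, if_pos ⟨hij, hk.1.symm, hk.2.symm, hl, ht⟩]
        rw [hs i k l t, hs j k l t, hs i k t t, hs j k t t]
        congr 1; ring
      · rw [if_neg hl, if_neg (by tauto)]; simp
    · rw [if_neg hk]
      refine Finset.sum_eq_zero fun l _ => ?_
      unfold vmul
      rw [if_neg (fun h => hk ⟨h.2.1.symm, h.2.2.1.symm⟩)]; simp
  have hmin : ∑ l ∈ Finset.univ.erase t, ∑ k ∈ S,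
      min (a k i l t / α + a k j t t / (β * d)) (a k j l t / α + a k i t t / (β * d)) =
      (2 * ((d : ℝ) - 2) * (n - 2) - (∑ k ∈ S, a k i t t + ∑ k ∈ S, a k j t t)) / (2 * α)
      + ((d : ℝ) - 1) * (∑ k ∈ S, a k i t t + ∑ k ∈ S, a k j t t) / (2 * β * d)
      - wmul n d a α β i j t / 2 := by
    rw [Finset.sum_comm, hw]
    have : ∀ k ∈ S, ∑ l ∈ Finset.univ.erase t,
        min (a k i l t / α + a k j t t / (β * d)) (a k j l t / α + a k i t t / (β * d)) =
        ((d : ℝ) - 2) / α + (((d : ℝ) - 1) / (2 * β * d) - 1 / (2 * α)) * a k i t t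
         + (((d : ℝ) - 1) / (2 * β * d) - 1 / (2 * α)) * a k j t t
         - (1 / 2) * ∑ l ∈ Finset.univ.erase t,
      |(a k i l t / α + a k j t t / (β * d)) - (a k j l t / α + a k i t t / (β * d))| := by
      intro k hk
      have hk' : k ≠ i ∧ k ≠ j := by simpa [hS] using hk
      have e : ∀ l, min (a k i l t / α + a k j t t / (β * d))
            (a k j l t / α + a k i t t / (β * d)) =
          (1 / (2 * α)) * a i k t l + (1 / (2 * α)) * a j k t l
          + (a k j t t + a k i t t) / (2 * β * d)
          - (1 / 2) * |(a k i l t / α + a k j t t / (β * d)) -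
            (a k j l t / α + a k i t t / (β * d))| := by
        intro l
        rw [min_half, hs i k l t, hs j k l t]
        field_simp
        ring
      simp only [e]
      rw [Finset.sum_sub_distrib, Finset.sum_add_distrib, Finset.sum_add_distrib,
        ← Finset.mul_sum, ← Finset.mul_sum, ← Finset.mul_sum, Finset.sum_const, nsmul_eq_mul,
        hdc, hr i k hk'.1.symm, hr j k hk'.2.symm, hs k i t t, hs k j t t]
      field_simp
      ring
    rw [Finset.sum_congr rfl this]
    rw [Finset.sum_sub_distrib, Finset.sum_add_distrib, Finset.sum_add_distrib,
        ← Finset.mul_sum, ← Finset.mul_sum, ← Finset.mul_sum, Finset.sum_const, nsmul_eq_mul,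
        hcard]
    field_simp
    ring
  have hlast : ∑ l ∈ Finset.univ.erase t,
          ((a i j t l + a j i t l) / α + 2 * a i j t t / (β * d)) =
      (2 * ((d : ℝ) - 2) - 2 * a i j t t) / α + 2 * (d - 1) * a i j t t / (β * d) := by
    rw [Finset.sum_add_distrib, ← Finset.sum_div, Finset.sum_add_distrib, Finset.sum_const,
      nsmul_eq_mul, hdc, hr i j hij, hr j i hij.symm, hs i j t t]
    ring
  have key : kappaJOM n d a α β i j t =
      1 - wmul n d a α β i j t / (2 * n) - ((d : ℝ) - 2) / (n * α) := by
    unfold kappaJOM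
    rw [hfl, hfi, hfi, ← hS, hmin, hlast, hSi, hSj, Finset.sum_insert hjS,
      Finset.sum_insert hiS, hs i j t t]
    field_simp
    ring
  rw [key]
  have : 0 ≤ ((d : ℝ) - 2) / (n * α) := div_nonneg (by linarith) (by positivity)
  linarith

lemma sum_pairs {n : ℕ} (f : Fin n → Fin n → ℝ) (h0 : ∀ i, f i i = 0) :
    ∑ i, ∑ j, f i j =
      ∑ p ∈ Finset.univ.filter (fun p : Fin n × Fin n => p.1 < p.2), (f p.1 p.2 + f p.2 p.1) := by
  have e : ∀ i j, f i j = (if i < j then f i j else 0) + (if j < i then f i j else 0) := by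
    intro i j
    rcases lt_trichotomy i j with h | h | h
    · simp [h, h.asymm]
    · subst h; simp [h0]
    · simp [h, h.asymm]
  rw [Finset.sum_filter, ← Finset.univ_product_univ, Finset.sum_product]
  have e2 : ∑ i, ∑ j, f i j = ∑ i, ∑ j, (if i < j then f i j else 0)
      + ∑ i, ∑ j, (if i < j then f j i else 0) := by
    rw [Finset.sum_comm (f := fun i j => if i < j then f j i else 0)]
    simp only [← Finset.sum_add_distrib]
    exact Finset.sum_congr rfl fun i _ => Finset.sum_congr rfl fun j _ => e i j
  rw [e2]
  simp only [← Finset.sum_add_distrib]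
  refine Finset.sum_congr rfl fun i _ => Finset.sum_congr rfl fun j _ => ?_
  split_ifs <;> simp

/-- Symmetric extension of an LP point. -/
def symExt {n d : ℕ} (Y : Fin n → Fin n → Matrix (Fin d) (Fin d) ℝ) :
    Fin n → Fin n → Matrix (Fin d) (Fin d) ℝ :=
  fun i j => if i < j then Y i j else if j < i then (Y j i)ᵀ else 1

lemma symExt_tri {n d : ℕ} (Y : Fin n → Fin n → Matrix (Fin d) (Fin d) ℝ)
    (h : lpFeasible n d Y) (k i j : Fin n) (h1 : k ≠ i) (h2 : k ≠ j) (h3 : i ≠ j)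
    (t q : Fin d) :
    |symExt Y i j t q - symExt Y k j t q| ≤ 1 - symExt Y k i t t := by
  obtain ⟨-, -, h, -⟩ := h
  rw [abs_le]
  unfold symExt
  rcases lt_or_gt_of_ne h1 with a1 | a1 <;> rcases lt_or_gt_of_ne h2 with a2 | a2 <;>
    rcases lt_or_gt_of_ne h3 with a3 | a3 <;>
    simp only [a1, a2, a3, a1.asymm, a2.asymm, a3.asymm, if_true, if_false, Matrix.transpose_apply]
  · have := h k i j a1 a3 t t q; constructor <;> linarith
  · have := h k j i a2 a3 t q t; constructor <;> linarith
  · exact absurd (a1.trans a3) a2.asymm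
  · have := h j k i a2 a1 q t t; constructor <;> linarith
  · have := h i k j a1 a2 t t q; constructor <;> linarith
  · exact absurd (a1.trans a2) a3.asymm
  · have := h i j k a3 a2 t q t; constructor <;> linarith
  · have := h j i k a3 a1 q t t; constructor <;> linarith

/-- Rewriting a diagonal charge through off-diagonal entries. -/
lemma diag_charge {d : ℕ} (M : Matrix (Fin d) (Fin d) ℝ) (w : Fin d → ℝ)
    (hr : ∀ t, ∑ q, M t q = 1) (hc : ∀ q, ∑ t, M t q = 1) :
    2 * ∑ t, w t * (1 - M t t) = ∑ t, ∑ q, (if q ≠ t then (w t + w q) * M t q else 0) := by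
  have e : ∀ t q, (if q ≠ t then (w t + w q) * M t q else 0) =
      (w t * M t q + w q * M t q) - (if q = t then 2 * w t * M t t else 0) := by
    intro t q
    by_cases h : q = t
    · subst h; simp; ring
    · simp [h]; ring
  simp only [e, Finset.sum_sub_distrib, Finset.sum_add_distrib]
  rw [Finset.sum_comm (f := fun t q => w q * M t q)]
  simp only [← Finset.mul_sum, hr, hc]
  simp only [Finset.sum_ite_eq', Finset.sum_ite_eq, Finset.mem_univ, if_true]
  simp only [Finset.mul_sum, ← Finset.sum_add_distrib, ← Finset.sum_sub_distrib]
  refine Finset.sum_congr rfl fun t _ => ?_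
  ring

lemma one_feasible (n d : ℕ) : lpFeasible n d (fun _ _ => 1) := by
  refine ⟨?_, ?_, ?_, ?_⟩
  · intro i j _ t; simp [Matrix.one_apply]
  · intro i j _ t; simp [Matrix.one_apply]
  · intro i j k _ _ l t q
    simp only [Matrix.one_apply]
    split_ifs <;> first | (exfalso; grind) | norm_num
  · intro i j _ t q
    simp only [Matrix.one_apply]
    split_ifs <;> norm_num

/-- Deterministic sufficient conditions (C1)–(C5) for the ground truth (all identity
matrices) to be an optimal solution of the basic LP (P). -/
theorem ground_truth_optimal_of_C1_to_C5
    (n d : ℕ) (hn : 3 ≤ n) (hd : 2 ≤ d)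
    (α β : ℝ) (hα : 0 < α) (hβ : 0 < β)
    (Xin : Fin n → Fin n → Matrix (Fin d) (Fin d) ℝ)
    (hperm : ∀ i j : Fin n, i < j → ∃ σ : Equiv.Perm (Fin d), Xin i j = permMat d σ)
    (htr : ∀ i j : Fin n, Xin j i = (Xin i j)ᵀ)
    (a : Fin n → Fin n → Matrix (Fin d) (Fin d) ℝ)
    (ha : ∀ (i j : Fin n) (t q : Fin d), a i j t q = 1 - 2 * Xin i j t q)
    (hC1 : ∀ i j : Fin n, i < j → ∀ t q : Fin d,
        a i j t t = 1 → a i j q q = 1 → a i j t q = 1 →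
        0 ≤ deltaJOM n d a α β i j t q ∧ 0 ≤ deltaJOM n d a α β j i q t)
    (hC2 : ∀ i j : Fin n, i < j → ∀ t q : Fin d,
        a i j t t = 1 → a i j q q = 1 → a i j t q = -1 →
        1 ≤ deltaJOM n d a α β i j t q ∧ 1 ≤ deltaJOM n d a α β j i q t)
    (hC3 : ∀ i j : Fin n, i < j → ∀ t q : Fin d,
        a i j t t = -1 → a i j q q = -1 → a i j t q = 1 →
        0 ≤ kappaJOM n d a α β i j t +
            (deltaJOM n d a α β i j t q + deltaJOM n d a α β j i q t) / 2 ∧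
        0 ≤ kappaJOM n d a α β i j q +
            (deltaJOM n d a α β i j t q + deltaJOM n d a α β j i q t) / 2)
    (hC4 : ∀ i j : Fin n, i < j → ∀ t q : Fin d,
        a i j t t = 1 → a i j q q = -1 → a i j t q = 1 →
        0 ≤ kappaJOM n d a α β i j q +
            deltaJOM n d a α β i j t q + deltaJOM n d a α β j i q t)
    (hC5 : ∀ i j : Fin n, i < j → ∀ t q : Fin d,
        a i j t t = -1 → a i j q q = 1 → a i j t q = 1 →
        0 ≤ kappaJOM n d a α β i j t +
            deltaJOM n d a α β i j t q + deltaJOM n d a α β j i q t) :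
    lpFeasible n d (fun _ _ => 1) ∧
      ∀ Y : Fin n → Fin n → Matrix (Fin d) (Fin d) ℝ,
        lpFeasible n d Y → lpObj n d a (fun _ _ => 1) ≤ lpObj n d a Y := by
  refine ⟨one_feasible n d, fun Y hY => ?_⟩
  have hn0 : (0 : ℝ) < n := by exact_mod_cast (by omega : 0 < n)
  have hs : ∀ i j t q, a j i t q = a i j q t := by
    intro i j t q
    rw [ha, ha, htr i j, Matrix.transpose_apply]
  have hrow : ∀ i j, i ≠ j → ∀ t, ∑ q, a i j t q = (d : ℝ) - 2 := by
    intro i j hij t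
    rcases lt_or_gt_of_ne hij with h | h
    · obtain ⟨σ, hσ⟩ := hperm i j h
      simp only [ha, hσ, permMat, Matrix.of_apply, Finset.sum_sub_distrib, ← Finset.mul_sum]
      have : ∀ q, (σ q = t) ↔ (q = σ.symm t) := fun q => by rw [Equiv.eq_symm_apply]
      simp [this]
    · obtain ⟨σ, hσ⟩ := hperm j i h
      simp only [ha, htr j i, hσ, permMat, Matrix.transpose_apply, Matrix.of_apply,
        Finset.sum_sub_distrib, ← Finset.mul_sum]
      simp
  have hpm : ∀ i j, i < j → ∀ t q, a i j t q = 1 ∨ a i j t q = -1 := by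
    intro i j h t q
    obtain ⟨σ, hσ⟩ := hperm i j h
    simp only [ha, hσ, permMat, Matrix.of_apply]
    split_ifs <;> norm_num
  have hex : ∀ i j, i < j → ∀ t q, q ≠ t → a i j t q = -1 →
      a i j t t = 1 ∧ a i j q q = 1 := by
    intro i j h t q hqt h1
    obtain ⟨σ, hσ⟩ := hperm i j h
    simp only [ha, hσ, permMat, Matrix.of_apply] at h1 ⊢
    have h2 : σ q = t := by
      by_contra hc
      rw [if_neg hc] at h1; norm_num at h1
    have h3 : σ t ≠ t := fun h => hqt (σ.injective (h2.trans h.symm))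
    have h4 : σ q ≠ q := fun h => hqt (h.symm.trans h2)
    rw [if_neg h3, if_neg h4]; norm_num
  have star := star_ineq n d a α β hs (symExt Y) (symExt_tri Y hY)
  rw [sum_pairs (fun i j => ∑ t, ∑ q, (∑ k, vmul n d a α β k i j t q) * symExt Y i j t q)
      (by intro i; refine Finset.sum_eq_zero fun t _ => Finset.sum_eq_zero fun q _ => ?_
          rw [vsum_zero _ _ _ _ _ _ _ _ _ (Or.inl rfl), zero_mul]),
    sum_pairs (fun i j => ∑ t, wmul n d a α β i j t * (1 - symExt Y i j t t))
      (by intro i; refine Finset.sum_eq_zero fun t _ => ?_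
          simp [symExt])] at star
  have main : ∀ p ∈ Finset.univ.filter (fun p : Fin n × Fin n => p.1 < p.2),
      2 * n * ∑ t, ∑ q, a p.1 p.2 t q * (1 : Matrix (Fin d) (Fin d) ℝ) t q
      ≤ 2 * n * (∑ t, ∑ q, a p.1 p.2 t q * Y p.1 p.2 t q)
      + 2 * (∑ t, ∑ q, (∑ k, vmul n d a α β k p.1 p.2 t q) * symExt Y p.1 p.2 t q
        + ∑ t, ∑ q, (∑ k, vmul n d a α β k p.2 p.1 t q) * symExt Y p.2 p.1 t q)
      - (∑ t, wmul n d a α β p.1 p.2 t * (1 - symExt Y p.1 p.2 t t)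
        + ∑ t, wmul n d a α β p.2 p.1 t * (1 - symExt Y p.2 p.1 t t)) := by
    rintro ⟨i, j⟩ hp
    have hij : i < j := by simpa using hp
    have hne : i ≠ j := hij.ne
    simp only [symExt, hij, hij.asymm, if_true, if_false, Matrix.transpose_apply]
    simp only [wmul_symm n d a α β hs i j]
    rw [Finset.sum_comm (f := fun t q => (∑ k, vmul n d a α β k j i t q) * Y i j q t)]
    have hr := hY.1 i j hij
    have hc := hY.2.1 i j hij
    have hpos := hY.2.2.2 i j hij
    have d1 := diag_charge (Y i j) (fun t => wmul n d a α β i j t) hr hc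
    have d2 := diag_charge (Y i j) (fun t => a i j t t) hr hc
    have o1 : ∑ t, ∑ q, a i j t q * (1 : Matrix (Fin d) (Fin d) ℝ) t q = ∑ t, a i j t t := by
      simp [Matrix.one_apply]
    have o2 : ∑ t, ∑ q, a i j t q * Y i j t q = ∑ t, a i j t t * Y i j t t
        + ∑ t, ∑ q, (if q ≠ t then a i j t q * Y i j t q else 0) := by
      rw [← Finset.sum_add_distrib]
      refine Finset.sum_congr rfl fun t _ => ?_
      rw [← Finset.add_sum_erase _ _ (Finset.mem_univ t),
        ← Finset.add_sum_erase _ (fun q => if q ≠ t then a i j t q * Y i j t q else 0)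
          (Finset.mem_univ t)]
      simp only [ne_eq, not_true_eq_false, if_false, zero_add]
      congr 1
      refine Finset.sum_congr rfl fun q hq => ?_
      rw [if_pos (Finset.ne_of_mem_erase hq)]
    simp only [mul_sub, mul_one, Finset.sum_sub_distrib] at d1 d2 ⊢
    have fin : 0 ≤ ∑ t, ∑ q, (n * (2 * (if q ≠ t then a i j t q * Y i j t q else 0)
        - (if q ≠ t then (a i j t t + a i j q q) * Y i j t q else 0))
        + 2 * ((∑ k, vmul n d a α β k i j t q) * Y i j t q)
        + 2 * ((∑ k, vmul n d a α β k j i q t) * Y i j t q)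
        - (if q ≠ t then (wmul n d a α β i j t + wmul n d a α β i j q) * Y i j t q else 0)) := by
      refine Finset.sum_nonneg fun t _ => Finset.sum_nonneg fun q _ => ?_
      by_cases hqt : q = t
      · rw [vsum_zero _ _ _ _ _ _ _ _ _ (Or.inr hqt),
          vsum_zero _ _ _ _ _ _ _ _ _ (Or.inr hqt.symm)]
        simp [hqt]
      · have e1 : ∑ k, vmul n d a α β k i j t q = n * deltaJOM n d a α β i j t q := by
          rw [delta_eq _ _ _ _ _ _ _ _ _ hne hqt]; field_simp
        have e2 : ∑ k, vmul n d a α β k j i q t = n * deltaJOM n d a α β j i q t := by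
          rw [delta_eq _ _ _ _ _ _ _ _ _ hne.symm (Ne.symm hqt)]; field_simp
        have w1 : a i j t t = -1 → wmul n d a α β i j t ≤
            2 * n * (1 - kappaJOM n d a α β i j t) := by
          intro h
          have := kappa_le n d hn hd a α β hα hβ hs hrow i j hne t h
          have h2 : wmul n d a α β i j t / (2 * n) ≤ 1 - kappaJOM n d a α β i j t := by linarith
          rw [div_le_iff₀ (by positivity)] at h2
          linarith
        have w2 : a i j q q = -1 → wmul n d a α β i j q ≤
            2 * n * (1 - kappaJOM n d a α β i j q) := by
          intro h
          have := kappa_le n d hn hd a α β hα hβ hs hrow i j hne q h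
          have h2 : wmul n d a α β i j q / (2 * n) ≤ 1 - kappaJOM n d a α β i j q := by linarith
          rw [div_le_iff₀ (by positivity)] at h2
          linarith
        have z1 := wmul_zero n d a α β i j t
        have z2 := wmul_zero n d a α β i j q
        have coef : 0 ≤ n * (2 * a i j t q - (a i j t t + a i j q q))
            + 2 * (n * deltaJOM n d a α β i j t q) + 2 * (n * deltaJOM n d a α β j i q t)
            - (wmul n d a α β i j t + wmul n d a α β i j q) := by
          rcases hpm i j hij t q with h | h
          · rcases hpm i j hij t t with h1 | h1 <;> rcases hpm i j hij q q with h2 | h2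
            · rw [z1 (by rw [h1]; norm_num), z2 (by rw [h2]; norm_num), h, h1, h2]
              obtain ⟨c1, c2⟩ := hC1 i j hij t q h1 h2 h
              have := mul_nonneg hn0.le c1
              have := mul_nonneg hn0.le c2
              linarith
            · rw [z1 (by rw [h1]; norm_num)]
              have c := mul_nonneg hn0.le (hC4 i j hij t q h1 h2 h)
              have := w2 h2
              rw [h, h1, h2]
              linarith
            · rw [z2 (by rw [h2]; norm_num)]
              have c := mul_nonneg hn0.le (hC5 i j hij t q h1 h2 h)
              have := w1 h1
              rw [h, h1, h2]
              linarith
            · obtain ⟨c1, c2⟩ := hC3 i j hij t q h1 h2 h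
              have := mul_nonneg hn0.le c1
              have := mul_nonneg hn0.le c2
              have := w1 h1
              have := w2 h2
              rw [h, h1, h2]
              linarith
          · obtain ⟨h1, h2⟩ := hex i j hij t q hqt h
            rw [z1 (by rw [h1]; norm_num), z2 (by rw [h2]; norm_num), h, h1, h2]
            obtain ⟨c1, c2⟩ := hC2 i j hij t q h1 h2 h
            have := mul_le_mul_of_nonneg_left c1 hn0.le
            have := mul_le_mul_of_nonneg_left c2 hn0.le
            linarith
        simp only [ne_eq, hqt, not_false_eq_true, if_true]
        rw [e1, e2]
        have := mul_nonneg coef (hpos t q)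
        linarith
    simp only [Finset.sum_add_distrib, Finset.sum_sub_distrib, ← Finset.mul_sum] at fin
    rw [o1, o2]
    rw [← d1, ← d2] at fin
    rw [Finset.sum_comm (f := fun q t => (∑ k, vmul n d a α β k j i t q) * Y i j q t)] at *
    linarith
  have tot := Finset.sum_le_sum main
  simp only [Finset.sum_add_distrib, Finset.sum_sub_distrib, ← Finset.mul_sum] at tot star
  unfold lpObj
  have : 2 * (n : ℝ) * ∑ p ∈ Finset.univ.filter (fun p : Fin n × Fin n => p.1 < p.2),
      ∑ t : Fin d, ∑ q : Fin d, a p.1 p.2 t q * (1 : Matrix (Fin d) (Fin d) ℝ) t q ≤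
      2 * (n : ℝ) * ∑ p ∈ Finset.univ.filter (fun p : Fin n × Fin n => p.1 < p.2),
      ∑ t : Fin d, ∑ q : Fin d, a p.1 p.2 t q * Y p.1 p.2 t q := by
    linarith
  exact le_of_mul_le_mul_left this (by positivity)

end
end
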